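/- Let A be a closed set of the form A = ⋃_{j=1}^{N} {x ∈ Ω : g_{j,1}(x) ≥ 0, …, g_{j,m_j}(x) ≥ 0}, where Ω ⊆ ℝ^n is an open ball centered at the origin 0 and each g_{j,i} : Ω → ℝ is real-analytic on Ω (every closed semianalytic germ has this form). Assume 0 ∈ A, 0 is not an isolated point of A, and A has empty interior in ℝ^n (codimension ≥ 1). Then for every real s ≥ 1 there exists a real polynomial P ∈ ℝ[x_1,…,x_n] with P(0) = 0 such that, setting Y = P^{-1}(0) (an algebraic subset of ℝ^n), 0 is not isolated in Y, the intersections A ∩ S_r and Y ∩ S_r are nonempty for all sufficiently small r > 0, and lim_{r→0⁺} D(A ∩ S_r, Y ∩ S_r)/r^s = 0, where S_r denotes the sphere in ℝ^n of radius r centered at 0 and D denotes the Hausdorff distance between nonempty compact sets. -/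

import Mathlib

open Metric Filter Set

section Helpers

open scoped NNReal ENNReal Topology

section SummableSeqTheory

/-- A sum of analytic functions whose power series are jointly normally convergent is analytic. -/
theorem analyticAt_tsum_of_summable_norm {E G : Type*} [NormedAddCommGroup E] [NormedSpace ℝ E]
    [NormedAddCommGroup G] [NormedSpace ℝ G] [CompleteSpace G]
    {F : ℕ → E → G} {q : ℕ → FormalMultilinearSeries ℝ E G} {r : ℝ≥0} (hr : 0 < r)
    (hF : ∀ j, HasFPowerSeriesOnBall (F j) (q j) 0 r)
    (hs : Summable fun x : ℕ × ℕ => ‖q x.1 x.2‖ * (r : ℝ) ^ x.2) :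
    AnalyticAt ℝ (fun z => ∑' j, F j z) 0 ∧ ∀ z, ‖z‖ < r → Summable fun j => F j z := by
  have hr' : (0 : ℝ) < r := hr
  have hs' : Summable fun x : ℕ × ℕ => ‖q x.2 x.1‖ * (r : ℝ) ^ x.1 :=
    (Equiv.prodComm ℕ ℕ).summable_iff.2 hs
  have hsm : ∀ m, Summable fun j => ‖q j m‖ := fun m => by
    have := hs'.prod_factor m
    exact (summable_mul_right_iff (pow_pos hr' m).ne').1 this
  have key : ∀ z : E, ‖z‖ < r →
      Summable fun x : ℕ × ℕ => q x.1 x.2 (fun _ => z) := fun z hz => by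
    refine Summable.of_norm_bounded hs fun x => ?_
    refine ((q x.1 x.2).le_opNorm _).trans ?_
    simp only [Finset.prod_const, Finset.card_univ, Fintype.card_fin]
    gcongr
  have hfib : ∀ z : E, ‖z‖ < r → ∀ j, HasSum (fun m => q j m (fun _ => z)) (F j z) :=
    fun z hz j => by
      have := (hF j).hasSum (y := z) (by simpa [Metric.mem_eball, edist_zero_right, enorm] using hz)
      simpa using this
  have hsum : ∀ z : E, ‖z‖ < r → HasSum (fun j => F j z) (∑' x : ℕ × ℕ, q x.1 x.2 (fun _ => z)) :=
    fun z hz => (key z hz).hasSum.prod_fiberwise (hfib z hz)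
  refine ⟨?_, fun z hz => (hsum z hz).summable⟩
  let Q : FormalMultilinearSeries ℝ E G := fun m => ∑' j, q j m
  have hQ : HasFPowerSeriesOnBall (fun z => ∑' j, F j z) Q 0 r := by
    refine ⟨?_, by exact_mod_cast hr, ?_⟩
    · refine Q.le_radius_of_summable_norm ?_
      refine Summable.of_nonneg_of_le (fun _ => by positivity) (fun m => ?_) hs'.prod
      have h1 : ‖∑' j, q j m‖ ≤ ∑' j, ‖q j m‖ := norm_tsum_le_tsum_norm (hsm m)
      calc ‖∑' j, q j m‖ * (r : ℝ) ^ m ≤ (∑' j, ‖q j m‖) * (r : ℝ) ^ m := by gcongr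
        _ = ∑' j, ‖q j m‖ * (r : ℝ) ^ m := tsum_mul_right.symm
    · intro y hy
      have hy' : ‖y‖ < r := by simpa [Metric.mem_eball, edist_zero_right, enorm] using hy
      rw [zero_add, (hsum y hy').tsum_eq]
      have h1 : HasSum (fun x : ℕ × ℕ => q x.2 x.1 (fun _ => y))
          (∑' x : ℕ × ℕ, q x.1 x.2 (fun _ => y)) :=
        (Equiv.prodComm ℕ ℕ).hasSum_iff.2 (key y hy').hasSum
      refine h1.prod_fiberwise fun m => ?_
      exact ((hsm m).of_norm.hasSum).map
        (ContinuousMultilinearMap.apply ℝ (fun _ : Fin m => E) G (fun _ => y)).toLinearMap.toAddMonoidHom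
        (ContinuousMultilinearMap.apply ℝ (fun _ : Fin m => E) G (fun _ => y)).continuous
  exact hQ.analyticAt

/-- The Banach space of absolutely summable real sequences. -/
abbrev SummableSeq := lp (fun _ : ℕ => ℝ) 1

namespace SummableSeq

theorem hasSum_norm (c : SummableSeq) : HasSum (fun j => ‖c j‖) ‖c‖ := by
  simpa using lp.hasSum_norm (p := 1) (by simp) c

theorem norm_apply_le (c : SummableSeq) (j : ℕ) : ‖c j‖ ≤ ‖c‖ :=
  le_hasSum (hasSum_norm c) j fun _ _ => norm_nonneg _

/-- The sequence with a single nonzero entry, equal to one. -/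
noncomputable def basis (j : ℕ) : SummableSeq := lp.single 1 j (1 : ℝ)

theorem norm_basis (j : ℕ) : ‖basis j‖ = 1 := by
  simp [basis, lp.norm_single]

theorem basis_apply (j k : ℕ) : basis j k = if k = j then 1 else 0 := by
  simp [basis, lp.single_apply, Pi.single_apply]

section lift

variable {G : Type*} [NormedAddCommGroup G] [NormedSpace ℝ G] [CompleteSpace G]

theorem summable_smul (v : ℕ → G) (hv : ∀ j, ‖v j‖ ≤ 1) (c : SummableSeq) :
    Summable fun j => c j • v j :=
  Summable.of_norm_bounded (hasSum_norm c).summable fun j => by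
    rw [norm_smul]
    exact mul_le_of_le_one_right (norm_nonneg _) (hv j)

/-- The continuous linear map sending the basis to a given family in the unit ball. -/
noncomputable def lift (v : ℕ → G) (hv : ∀ j, ‖v j‖ ≤ 1) : SummableSeq →L[ℝ] G :=
  LinearMap.mkContinuous
    { toFun := fun c => ∑' j, c j • v j
      map_add' := fun a b => by
        rw [← (summable_smul v hv a).tsum_add (summable_smul v hv b)]
        simp [add_smul]
      map_smul' := fun a b => by
        rw [RingHom.id_apply, ← (summable_smul v hv b).tsum_const_smul]
        simp [mul_smul] } 1 fun c => by
    rw [one_mul]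
    refine tsum_of_norm_bounded (hasSum_norm c) fun j => ?_
    rw [norm_smul]
    exact mul_le_of_le_one_right (norm_nonneg _) (hv j)

theorem hasSum_lift (v : ℕ → G) (hv : ∀ j, ‖v j‖ ≤ 1) (c : SummableSeq) :
    HasSum (fun j => c j • v j) (lift v hv c) :=
  (summable_smul v hv c).hasSum

end lift

/-- The coordinate functionals. -/
noncomputable def coord (k : ℕ) : SummableSeq →L[ℝ] ℝ :=
  LinearMap.mkContinuous
    { toFun := fun c => c k, map_add' := fun _ _ => rfl, map_smul' := fun _ _ => rfl } 1
    fun c => by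
      rw [one_mul]
      exact norm_apply_le c k

@[simp] theorem coord_apply (k : ℕ) (c : SummableSeq) : coord k c = c k := rfl

theorem norm_coord_le (k : ℕ) : ‖coord k‖ ≤ 1 := LinearMap.mkContinuous_norm_le _ zero_le_one _

/-- The right shift. -/
noncomputable def shiftRight (d : ℕ) : SummableSeq →L[ℝ] SummableSeq :=
  lift (fun j => basis (j + d)) fun _ => (norm_basis _).le

/-- The left shift. -/
noncomputable def shiftLeft (d : ℕ) : SummableSeq →L[ℝ] SummableSeq :=
  lift (fun j => if d ≤ j then basis (j - d) else 0) fun j => by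
    split_ifs
    · exact (norm_basis _).le
    · simp

theorem shiftRight_apply (d : ℕ) (c : SummableSeq) (k : ℕ) :
    shiftRight d c k = if d ≤ k then c (k - d) else 0 := by
  have h := (hasSum_lift (fun j => basis (j + d)) (fun j => (norm_basis _).le) c).mapL (coord k)
  simp only [map_smul, coord_apply, basis_apply, smul_eq_mul] at h
  refine h.unique ?_
  split_ifs with hk
  · convert hasSum_single (k - d) ?_ using 1
    · rw [if_pos (by omega), mul_one]
    · intro j hj
      rw [if_neg (by omega), mul_zero]
  · convert hasSum_zero with j
    rw [if_neg (by omega), mul_zero]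

theorem shiftLeft_apply (d : ℕ) (c : SummableSeq) (k : ℕ) : shiftLeft d c k = c (k + d) := by
  have h := (hasSum_lift (fun j => if d ≤ j then basis (j - d) else 0) (fun j => by
    split_ifs
    · exact (norm_basis _).le
    · simp) c).mapL (coord k)
  refine h.unique ?_
  convert hasSum_single (k + d) ?_ using 1
  · simp [basis_apply]
  · intro j hj
    rw [map_smul]
    split_ifs with hd
    · rw [coord_apply, basis_apply, if_neg (by omega), smul_zero]
    · simp

/-- Evaluation of the power series with the given coefficients. -/
noncomputable def eval (u : ℝ) : SummableSeq →L[ℝ] ℝ := ∑' j, u ^ j • coord j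

theorem hasSum_eval_clm {u : ℝ} (hu : |u| < 1) : HasSum (fun j => u ^ j • coord j) (eval u) := by
  refine (Summable.of_norm_bounded (summable_geometric_of_lt_one (abs_nonneg u) hu)
    fun j => ?_).hasSum
  rw [norm_smul, norm_pow, Real.norm_eq_abs]
  exact mul_le_of_le_one_right (by positivity) (norm_coord_le j)

theorem hasSum_eval {u : ℝ} (hu : |u| < 1) (c : SummableSeq) :
    HasSum (fun j => u ^ j * c j) (eval u c) := by
  simpa using (hasSum_eval_clm hu).mapL (ContinuousLinearMap.apply ℝ ℝ c)

theorem analyticAt_eval : AnalyticAt ℝ eval 0 := by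
  let p : FormalMultilinearSeries ℝ ℝ (SummableSeq →L[ℝ] ℝ) :=
    fun j => ContinuousMultilinearMap.mkPiRing ℝ (Fin j) (coord j)
  refine ⟨p, hasFPowerSeriesAt_iff.2 ?_⟩
  filter_upwards [Metric.ball_mem_nhds (0 : ℝ) one_pos] with u hu
  have h1 : (fun j => u ^ j • p.coeff j) = fun j => u ^ j • coord j := by
    funext j
    congr 1
    ext v
    simp [FormalMultilinearSeries.coeff, p]
  rw [zero_add, h1]
  exact hasSum_eval_clm (by simpa using hu)

theorem analyticAt_eval_apply {E : Type*} [NormedAddCommGroup E] [NormedSpace ℝ E]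
    {h : E → ℝ} {c : E → SummableSeq} {z : E} (hh : AnalyticAt ℝ h z) (h0 : h z = 0)
    (hc : AnalyticAt ℝ c z) : AnalyticAt ℝ (fun x => eval (h x) (c x)) z := by
  have h1 : AnalyticAt ℝ (fun x => eval (h x)) z :=
    AnalyticAt.fun_comp (g := eval) (by rw [h0]; exact analyticAt_eval) hh
  exact (ContDiffAt.clm_apply (n := ⊤) h1.contDiffAt hc.contDiffAt).analyticAt

theorem eval_zero (c : SummableSeq) : eval 0 c = c 0 := by
  have h := hasSum_eval (u := 0) (by simp) c
  refine h.unique ?_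
  convert hasSum_single (f := fun j => (0 : ℝ) ^ j * c j) 0 ?_ using 1
  · simp
  · intro j hj
    simp [hj]

theorem eval_shiftRight {u : ℝ} (hu : |u| < 1) (d : ℕ) (c : SummableSeq) :
    eval u (shiftRight d c) = u ^ d * eval u c := by
  have h1 := (hasSum_eval hu c).mul_left (u ^ d)
  have h2 := hasSum_eval hu (shiftRight d c)
  rw [← hasSum_nat_add_iff' d] at h2
  have h3 : ∑ i ∈ Finset.range d, u ^ i * (shiftRight d c) i = 0 :=
    Finset.sum_eq_zero fun i hi => by
      rw [shiftRight_apply, if_neg (by simpa using hi), mul_zero]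
  rw [h3, sub_zero] at h2
  refine h2.unique ?_
  have h4 : (fun j => u ^ (j + d) * shiftRight d c (j + d)) = fun j => u ^ d * (u ^ j * c j) := by
    funext j
    rw [shiftRight_apply, if_pos (by omega), Nat.add_sub_cancel, pow_add]
    ring
  rwa [h4]

theorem shiftRight_shiftLeft {d : ℕ} {c : SummableSeq} (hc : ∀ j < d, c j = 0) :
    shiftRight d (shiftLeft d c) = c := by
  ext k
  rw [shiftRight_apply, shiftLeft_apply]
  split_ifs with h
  · rw [Nat.sub_add_cancel h]
  · exact (hc k (by omega)).symm

theorem shiftLeft_shiftRight (d : ℕ) (c : SummableSeq) : shiftLeft d (shiftRight d c) = c := by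
  ext k
  rw [shiftLeft_apply, shiftRight_apply, if_pos (by omega), Nat.add_sub_cancel]

end SummableSeq

/-- Taylor expansion of an analytic function in its last variable, as an analytic family of
absolutely summable sequences. -/
theorem AnalyticAt.exists_summableSeq {E : Type*} [NormedAddCommGroup E] [NormedSpace ℝ E]
    {f : E × ℝ → ℝ} {z₀ : E} (hf : AnalyticAt ℝ f (z₀, 0)) :
    ∃ ρ : ℝ, 0 < ρ ∧ ∃ c : E → SummableSeq, AnalyticAt ℝ c z₀ ∧
      ∀ᶠ z in 𝓝 z₀, ∀ u : ℝ, |u| < 1 → f (z, ρ * u) = SummableSeq.eval u (c z) := by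
  obtain ⟨p, R, hp⟩ := hf
  obtain ⟨r', hr'0, hr'R⟩ := ENNReal.lt_iff_exists_nnreal_btwn.1 hp.r_pos
  have hr'0 : 0 < r' := by exact_mod_cast hr'0
  set r : ℝ≥0 := r' / 2 with hr
  have hr0 : 0 < r := half_pos hr'0
  have hrr : (r : ℝ≥0∞) + r < p.radius := by
    rw [← ENNReal.coe_add, hr, add_halves]
    exact hr'R.trans_le hp.r_le
  have hrp : (r : ℝ≥0∞) < p.radius := lt_of_le_of_lt le_self_add hrr
  have hp0 : 0 < p.radius := lt_of_le_of_lt zero_le hrp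
  let e : E × ℝ := (0, (r : ℝ))
  have he : ‖e‖ = r := by simp [e, Prod.norm_def]
  let T : (j : ℕ) → ((E × ℝ) [×j]→L[ℝ] ℝ) →L[ℝ] SummableSeq := fun j =>
    (ContinuousMultilinearMap.apply ℝ (fun _ : Fin j => E × ℝ) ℝ (fun _ => e)).smulRight
      (SummableSeq.basis j)
  have hT : ∀ j (M : (E × ℝ) [×j]→L[ℝ] ℝ), T j M = M (fun _ => e) • SummableSeq.basis j :=
    fun j M => rfl
  have hTn : ∀ j, ‖T j‖ ≤ (r : ℝ) ^ j := fun j => by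
    refine ContinuousLinearMap.opNorm_le_bound _ (by positivity) fun M => ?_
    rw [hT, norm_smul, SummableSeq.norm_basis, mul_one]
    refine (M.le_opNorm _).trans ?_
    simp [he, mul_comm]
  let q : ℕ → FormalMultilinearSeries ℝ (E × ℝ) SummableSeq := fun j =>
    (T j).compFormalMultilinearSeries (p.changeOriginSeries j)
  let F : ℕ → E × ℝ → SummableSeq := fun j v => T j (p.changeOrigin v j)
  have hF : ∀ j, HasFPowerSeriesOnBall (F j) (q j) 0 r := fun j =>
    ((T j).comp_hasFPowerSeriesOnBall (p.hasFPowerSeriesOnBall_changeOrigin j hp0)).mono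
      (by exact_mod_cast hr0) hrp.le
  have hs : Summable fun x : ℕ × ℕ => ‖q x.1 x.2‖ * (r : ℝ) ^ x.2 := by
    have h1 := p.changeOriginSeries_summable_aux₁ hrr
    have h2 : Summable fun x : ℕ × ℕ => ‖p.changeOriginSeries x.1 x.2‖₊ * r ^ x.2 * r ^ x.1 := by
      obtain ⟨h3, h4⟩ := NNReal.summable_sigma.1 h1
      rw [← (Equiv.sigmaEquivProd ℕ ℕ).summable_iff]
      have hle : ∀ k l : ℕ, ‖p.changeOriginSeries k l‖₊ * r ^ l * r ^ k ≤
          ∑' _ : { s : Finset (Fin (k + l)) // s.card = l }, ‖p (k + l)‖₊ * r ^ l * r ^ k :=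
        fun k l => by
          rw [NNReal.tsum_mul_right, NNReal.tsum_mul_right]
          gcongr
          exact p.nnnorm_changeOriginSeries_le_tsum k l
      have h5 : ∀ k : ℕ, Summable fun l => ‖p.changeOriginSeries k l‖₊ * r ^ l * r ^ k := fun k =>
        NNReal.summable_of_le (hle k) (NNReal.summable_sigma.1 (h3 k)).2
      refine NNReal.summable_sigma.2 ⟨h5, NNReal.summable_of_le (fun k => ?_) h4⟩
      refine ((h5 k).tsum_le_tsum (hle k) (NNReal.summable_sigma.1 (h3 k)).2).trans_eq ?_
      exact ((h3 k).tsum_sigma' (NNReal.summable_sigma.1 (h3 k)).1).symm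
    refine Summable.of_nonneg_of_le (fun _ => by positivity) (fun x => ?_) (NNReal.summable_coe.2 h2)
    push_cast
    have : ‖q x.1 x.2‖ ≤ r ^ x.1 * ‖p.changeOriginSeries x.1 x.2‖ :=
      ((T x.1).norm_compContinuousMultilinearMap_le _).trans (by gcongr; exact hTn _)
    calc ‖q x.1 x.2‖ * (r : ℝ) ^ x.2 ≤ (r ^ x.1 * ‖p.changeOriginSeries x.1 x.2‖) * (r : ℝ) ^ x.2 := by
          gcongr
      _ = _ := by ring
  obtain ⟨hC, hCs⟩ := analyticAt_tsum_of_summable_norm hr0 hF hs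
  refine ⟨r, hr0, fun z => ∑' j, F j (z - z₀, 0), ?_, ?_⟩
  · refine AnalyticAt.fun_comp (g := fun v => ∑' j, F j v) (f := fun z : E => (z - z₀, (0 : ℝ))) ?_ ?_
    · rwa [sub_self, Prod.mk_zero_zero]
    · fun_prop
  · filter_upwards [Metric.ball_mem_nhds z₀ (show (0 : ℝ) < r from hr0)] with z hz u hu
    have hz' : ‖z - z₀‖ < r := by simpa [dist_eq_norm] using hz
    have hx : ‖((z - z₀, 0) : E × ℝ)‖ < r := by
      simpa [Prod.norm_def] using hz'
    have h1 : f (z, r * u) = p.sum ((z - z₀, 0) + (0, r * u)) := by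
      rw [← hp.sum]
      · simp
      · have : ‖((z - z₀, 0) + (0, r * u) : E × ℝ)‖ < r' := by
          have hru : |r * u| < r := by
            rw [abs_mul, abs_of_pos (show (0 : ℝ) < r from hr0)]
            exact mul_lt_of_lt_one_right hr0 hu
          have : (r : ℝ) ≤ r' := by exact_mod_cast half_le_self (zero_le)
          simp only [Prod.mk_add_mk, add_zero, zero_add, Prod.norm_def, Real.norm_eq_abs]
          exact max_lt (hz'.trans_le this) (hru.trans_le this)
        refine Metric.eball_subset_eball hr'R.le ?_
        rw [Metric.mem_eball, edist_zero_right, enorm_eq_nnnorm]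
        exact_mod_cast this
    have h2 : p.sum ((z - z₀, 0) + (0, r * u)) = (p.changeOrigin (z - z₀, 0)).sum (0, r * u) := by
      refine (p.changeOrigin_eval (lt_of_le_of_lt ?_ hrr)).symm
      gcongr
      · exact hx.le
      · rw [← NNReal.coe_le_coe]
        simp only [coe_nnnorm, Prod.norm_def, norm_zero, norm_mul, Real.norm_eq_abs, NNReal.abs_eq]
        refine max_le (by positivity) (mul_le_of_le_one_right (by positivity) hu.le)
    have hco : ∀ k, (∑' j, F j (z - z₀, 0) : SummableSeq) k =
        p.changeOrigin (z - z₀, 0) k (fun _ => e) := fun k => by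
      have h := (hCs _ hx).hasSum.mapL (SummableSeq.coord k)
      refine h.unique ?_
      convert hasSum_single k ?_ using 1
      · simp [F, hT, SummableSeq.basis_apply]
      · intro j hj
        simp [F, hT, SummableSeq.basis_apply, hj.symm]
    rw [h1, h2, FormalMultilinearSeries.sum, ← (SummableSeq.hasSum_eval hu _).tsum_eq]
    refine tsum_congr fun j => ?_
    rw [hco]
    have : (fun _ : Fin j => ((0, r * u) : E × ℝ)) = fun _ => u • e := by
      simp [e, mul_comm]
    rw [this, ContinuousMultilinearMap.map_smul_univ]
    simp

end SummableSeqTheory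

section WeierstrassDivisionTheory

variable {E : Type*} [NormedAddCommGroup E] [NormedSpace ℝ E]

theorem AnalyticAt.exists_eq_pow_mul {f : E × ℝ → ℝ} {z₀ : E} (hf : AnalyticAt ℝ f (z₀, 0))
    (hne : ¬ ∀ᶠ p in 𝓝 (z₀, 0), f p = 0) :
    ∃ (a : ℕ) (f' : E × ℝ → ℝ), AnalyticAt ℝ f' (z₀, 0) ∧ (¬ ∀ᶠ z in 𝓝 z₀, f' (z, 0) = 0) ∧
      ∀ᶠ p in 𝓝 (z₀, 0), f p = p.2 ^ a * f' p := by
  obtain ⟨ρ, hρ, c, hc, hfc⟩ := hf.exists_summableSeq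
  have hpair : ∀ᶠ p : E × ℝ in 𝓝 (z₀, 0), |p.2 / ρ| < 1 ∧
      ∀ u : ℝ, |u| < 1 → f (p.1, ρ * u) = SummableSeq.eval u (c p.1) := by
    rw [nhds_prod_eq]
    have h1 : ∀ᶠ t : ℝ in 𝓝 0, |t / ρ| < 1 := by
      have : Tendsto (fun t : ℝ => |t / ρ|) (𝓝 0) (𝓝 |0 / ρ|) :=
        Continuous.tendsto (by fun_prop) 0
      exact this.eventually_lt_const (by simp)
    filter_upwards [hfc.prod_mk h1] with p hp using ⟨hp.2, hp.1⟩
  have hsub : ∀ᶠ p : E × ℝ in 𝓝 (z₀, 0), |p.2 / ρ| < 1 ∧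
      f p = SummableSeq.eval (p.2 / ρ) (c p.1) := by
    filter_upwards [hpair] with p hp
    refine ⟨hp.1, ?_⟩
    rw [← hp.2 _ hp.1, mul_div_cancel₀ _ hρ.ne']
  have hex : ∃ k, ¬ ∀ᶠ z in 𝓝 z₀, c z k = 0 := by
    by_contra! hall
    obtain ⟨ε, hε, hb⟩ := Metric.eventually_nhds_iff_ball.1 hc.eventually_analyticAt
    have hz : ∀ z ∈ ball z₀ ε, c z = 0 := fun z hz => by
      ext k
      have h1 : AnalyticOnNhd ℝ (fun z => SummableSeq.coord k (c z)) (ball z₀ ε) :=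
        fun z hz => ((SummableSeq.coord k).analyticAt _).fun_comp (hb z hz)
      exact h1.eqOn_zero_of_preconnected_of_eventuallyEq_zero (convex_ball z₀ ε).isPreconnected
        (mem_ball_self hε) (hall k) hz
    refine hne ?_
    have h2 : ∀ᶠ p : E × ℝ in 𝓝 (z₀, 0), p.1 ∈ ball z₀ ε :=
      (continuous_fst.tendsto (z₀, (0 : ℝ))).eventually (ball_mem_nhds z₀ hε)
    filter_upwards [hsub, h2] with p hp hp2
    rw [hp.2, hz _ hp2, map_zero]
  classical
  have hlt : ∀ᶠ z in 𝓝 z₀, ∀ j < Nat.find hex, c z j = 0 := by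
    have : ∀ᶠ z in 𝓝 z₀, ∀ j ∈ Finset.range (Nat.find hex), c z j = 0 := by
      rw [Filter.eventually_all_finset]
      intro j hj
      exact not_not.1 (Nat.find_min hex (Finset.mem_range.1 hj))
    simpa using this
  set a := Nat.find hex with ha
  refine ⟨a, fun p => (ρ ^ a)⁻¹ * SummableSeq.eval (p.2 / ρ) (SummableSeq.shiftLeft a (c p.1)),
    ?_, ?_, ?_⟩
  · refine analyticAt_const.mul (SummableSeq.analyticAt_eval_apply ?_ (by simp) ?_)
    · exact analyticAt_snd.div_const
    · exact ((SummableSeq.shiftLeft a).analyticAt _).fun_comp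
        (AnalyticAt.fun_comp (g := c) (f := Prod.fst) hc analyticAt_fst)
  · intro h
    refine Nat.find_spec hex ?_
    filter_upwards [h] with z hz
    change c z a = 0
    simpa [SummableSeq.eval_zero, SummableSeq.shiftLeft_apply, hρ.ne'] using hz
  · have h2 : ∀ᶠ p : E × ℝ in 𝓝 (z₀, 0), ∀ j < a, c p.1 j = 0 :=
      (continuous_fst.tendsto (z₀, (0 : ℝ))).eventually hlt
    filter_upwards [hsub, h2] with p hp hp2
    rw [hp.2]
    conv_lhs => rw [← SummableSeq.shiftRight_shiftLeft hp2]
    rw [SummableSeq.eval_shiftRight hp.1, div_pow]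
    field_simp

namespace SummableSeq

/-- The derivative of the Weierstrass product map
`(w, v) ↦ (u ^ d + ∑ j < d, w j * u ^ j) * v` at `(0, v₀)`. -/
noncomputable def weierstrassDeriv (d : ℕ) (v₀ : SummableSeq) :
    (Fin d → ℝ) × SummableSeq →L[ℝ] SummableSeq :=
  (shiftRight d).comp (ContinuousLinearMap.snd ℝ _ _) +
    ∑ j : Fin d, ((ContinuousLinearMap.proj j).comp
      (ContinuousLinearMap.fst ℝ (Fin d → ℝ) SummableSeq)).smulRight (shiftRight j v₀)

theorem weierstrassDeriv_apply (d : ℕ) (v₀ : SummableSeq) (x : (Fin d → ℝ) × SummableSeq) :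
    weierstrassDeriv d v₀ x = shiftRight d x.2 + ∑ j : Fin d, x.1 j • shiftRight j v₀ := by
  simp [weierstrassDeriv]

theorem coord_sum_smul_shiftRight (d : ℕ) (v₀ : SummableSeq) (w : Fin d → ℝ) (k : Fin d) :
    coord k (∑ j : Fin d, w j • shiftRight j v₀) =
      w k * v₀ 0 + ∑ j ∈ Finset.univ.filter (fun j => j < k), w j * v₀ (k - j) := by
  rw [map_sum]
  have h1 : ∀ j : Fin d, coord k (w j • shiftRight j v₀) =
      (if j = k then w k * v₀ 0 else 0) + if j < k then w j * v₀ (k - j) else 0 := fun j => by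
    rw [map_smul, coord_apply, shiftRight_apply, smul_eq_mul]
    rcases lt_trichotomy j k with h | h | h
    · rw [if_pos (by exact_mod_cast h.le), if_neg h.ne, if_pos h, zero_add]
    · subst h
      simp
    · rw [if_neg (by simpa using h), if_neg h.ne', if_neg h.not_gt]
      simp
  rw [Finset.sum_congr rfl fun j _ => h1 j, Finset.sum_add_distrib, Finset.sum_filter]
  simp

theorem eq_zero_of_coord_sum_eq_zero {d : ℕ} {v₀ : SummableSeq} (h0 : v₀ 0 ≠ 0) {w : Fin d → ℝ}
    (hw : ∀ k : Fin d, coord k (∑ j : Fin d, w j • shiftRight j v₀) = 0) : w = 0 := by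
  funext k
  induction k using WellFoundedLT.induction with
  | ind k ih =>
    have h := hw k
    rw [coord_sum_smul_shiftRight, Finset.sum_eq_zero, add_zero] at h
    · exact (mul_eq_zero.1 h).resolve_right h0
    · intro j hj
      rw [ih j (by simpa using hj)]
      simp

theorem weierstrassDeriv_bijective {d : ℕ} {v₀ : SummableSeq} (h0 : v₀ 0 ≠ 0) :
    Function.Bijective (weierstrassDeriv d v₀) := by
  have hlow : ∀ (v : SummableSeq) (k : Fin d), coord k (shiftRight d v) = 0 := fun v k => by
    rw [coord_apply, shiftRight_apply, if_neg (by simp)]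
  constructor
  · rw [injective_iff_map_eq_zero]
    rintro ⟨w, v⟩ h
    rw [weierstrassDeriv_apply] at h
    have hw : w = 0 := eq_zero_of_coord_sum_eq_zero h0 fun k => by
      have := congrArg (coord k) h
      rwa [map_add, hlow, zero_add, map_zero] at this
    subst hw
    have hv : shiftRight d v = 0 := by simpa using h
    have := shiftLeft_shiftRight d v
    rw [hv, map_zero] at this
    rw [← this]
    rfl
  · intro b
    let T : (Fin d → ℝ) →ₗ[ℝ] (Fin d → ℝ) :=
      LinearMap.pi fun k => (coord (k : ℕ)).toLinearMap ∘ₗ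
        ∑ j : Fin d, (LinearMap.proj j).smulRight (shiftRight j v₀)
    have hT : ∀ w k, T w k = coord k (∑ j : Fin d, w j • shiftRight j v₀) := fun w k => by
      simp [T]
    have hinj : Function.Injective T := by
      rw [injective_iff_map_eq_zero]
      intro w hw
      exact eq_zero_of_coord_sum_eq_zero h0 fun k => by rw [← hT, hw]; rfl
    obtain ⟨w, hw⟩ := LinearMap.injective_iff_surjective.1 hinj (fun k => b k)
    refine ⟨(w, shiftLeft d (b - ∑ j : Fin d, w j • shiftRight j v₀)), ?_⟩
    rw [weierstrassDeriv_apply, shiftRight_shiftLeft, sub_add_cancel]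
    intro j hj
    have := congrFun hw ⟨j, hj⟩
    rw [hT] at this
    change coord j (b - _) = 0
    rw [map_sub, this, coord_apply, sub_self]

/-- The Weierstrass product map `(w, v) ↦ (u ^ d + ∑ j < d, w j * u ^ j) * v`. -/
noncomputable def weierstrassMul (d : ℕ) (x : (Fin d → ℝ) × SummableSeq) : SummableSeq :=
  shiftRight d x.2 + ∑ j : Fin d, x.1 j • shiftRight j x.2

theorem analyticAt_weierstrassMul (d : ℕ) (x : (Fin d → ℝ) × SummableSeq) :
    AnalyticAt ℝ (weierstrassMul d) x := by
  have h : ∀ k, AnalyticAt ℝ (fun x : (Fin d → ℝ) × SummableSeq => shiftRight k x.2) x :=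
    fun k => ((shiftRight k).analyticAt _).fun_comp analyticAt_snd
  refine (h d).add (Finset.analyticAt_fun_sum _ fun j _ => ?_)
  have hp : AnalyticAt ℝ (fun x : (Fin d → ℝ) × SummableSeq => x.1 j) x :=
    ((ContinuousLinearMap.proj (R := ℝ) (φ := fun _ : Fin d => ℝ) j).analyticAt _).fun_comp
      analyticAt_fst
  exact hp.smul (h j)

theorem hasFDerivAt_weierstrassMul (d : ℕ) (v₀ : SummableSeq) :
    HasFDerivAt (weierstrassMul d) (weierstrassDeriv d v₀) (0, v₀) := by
  have h : ∀ k, HasFDerivAt (fun x : (Fin d → ℝ) × SummableSeq => shiftRight k x.2)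
      ((shiftRight k).comp (ContinuousLinearMap.snd ℝ _ _)) (0, v₀) :=
    fun k => (shiftRight k).hasFDerivAt.comp _ hasFDerivAt_snd
  have hp : ∀ j : Fin d, HasFDerivAt (fun x : (Fin d → ℝ) × SummableSeq => x.1 j)
      ((ContinuousLinearMap.proj j).comp (ContinuousLinearMap.fst ℝ (Fin d → ℝ) SummableSeq))
      (0, v₀) := fun j =>
    (ContinuousLinearMap.proj (R := ℝ) (φ := fun _ : Fin d => ℝ) j).hasFDerivAt.comp _
      hasFDerivAt_fst
  refine ((h d).add (HasFDerivAt.fun_sum fun j _ => (hp j).smul (h j))).congr_fderiv ?_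
  ext x <;> simp [weierstrassDeriv]

theorem eval_weierstrassMul {u : ℝ} (hu : |u| < 1) (d : ℕ) (x : (Fin d → ℝ) × SummableSeq) :
    eval u (weierstrassMul d x) = (u ^ d + ∑ j : Fin d, x.1 j * u ^ (j : ℕ)) * eval u x.2 := by
  rw [weierstrassMul, map_add, map_sum, eval_shiftRight hu, add_mul, Finset.sum_mul]
  congr 1
  refine Finset.sum_congr rfl fun j _ => ?_
  rw [map_smul, eval_shiftRight hu, smul_eq_mul, mul_assoc]

end SummableSeq

/-- **Weierstrass preparation theorem** for real-analytic functions. -/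
theorem AnalyticAt.exists_weierstrass {f : E × ℝ → ℝ} {z₀ : E} (hf : AnalyticAt ℝ f (z₀, 0))
    (hne : ¬ ∀ᶠ s in 𝓝 (0 : ℝ), f (z₀, s) = 0) :
    ∃ (d : ℕ) (a : Fin d → E → ℝ) (u : E × ℝ → ℝ), (∀ j, AnalyticAt ℝ (a j) z₀) ∧
      AnalyticAt ℝ u (z₀, 0) ∧ u (z₀, 0) ≠ 0 ∧
      ∀ᶠ p in 𝓝 (z₀, 0), f p = u p * (p.2 ^ d + ∑ j, a j p.1 * p.2 ^ (j : ℕ)) := by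
  obtain ⟨ρ, hρ, c, hc, hfc⟩ := hf.exists_summableSeq
  have h1 : ∀ᶠ t : ℝ in 𝓝 0, |t / ρ| < 1 := by
    have : Tendsto (fun t : ℝ => |t / ρ|) (𝓝 0) (𝓝 |0 / ρ|) :=
      Continuous.tendsto (by fun_prop) 0
    exact this.eventually_lt_const (by simp)
  have hex : ∃ k, c z₀ k ≠ 0 := by
    by_contra! hall
    have hc0 : c z₀ = 0 := by ext k; exact hall k
    refine hne ?_
    filter_upwards [h1] with s hs
    have := hfc.self_of_nhds _ hs
    rwa [mul_div_cancel₀ _ hρ.ne', hc0, map_zero] at this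
  classical
  set d := Nat.find hex with hd
  set v₀ := SummableSeq.shiftLeft d (c z₀) with hv₀
  have hv₀0 : v₀ 0 ≠ 0 := by
    rw [hv₀, SummableSeq.shiftLeft_apply, zero_add]
    exact Nat.find_spec hex
  have hcz : SummableSeq.weierstrassMul d (0, v₀) = c z₀ := by
    have : SummableSeq.shiftRight d v₀ = c z₀ :=
      SummableSeq.shiftRight_shiftLeft fun j hj => not_not.1 (Nat.find_min hex hj)
    simp [SummableSeq.weierstrassMul, this]
  have hbij := SummableSeq.weierstrassDeriv_bijective (d := d) hv₀0
  let L := ContinuousLinearEquiv.ofBijective (SummableSeq.weierstrassDeriv d v₀)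
    (LinearMap.ker_eq_bot.2 hbij.1) (LinearMap.range_eq_top.2 hbij.2)
  have hL : HasFDerivAt (SummableSeq.weierstrassMul d)
      (L : (Fin d → ℝ) × SummableSeq →L[ℝ] SummableSeq) (0, v₀) :=
    SummableSeq.hasFDerivAt_weierstrassMul d v₀
  have hcd : ContDiffAt ℝ ⊤ (SummableSeq.weierstrassMul d) (0, v₀) :=
    (SummableSeq.analyticAt_weierstrassMul d _).contDiffAt
  set G := hcd.localInverse hL (by simp) with hG
  have hGan : AnalyticAt ℝ G (c z₀) := by
    rw [← hcz]
    exact (hcd.to_localInverse hL (by simp)).analyticAt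
  have hGv : G (c z₀) = (0, v₀) := by
    rw [← hcz]
    exact hcd.localInverse_apply_image hL (by simp)
  have hGr : ∀ᶠ y in 𝓝 (c z₀), SummableSeq.weierstrassMul d (G y) = y := by
    rw [← hcz]
    exact (hcd.hasStrictFDerivAt' hL (by simp)).eventually_right_inverse
  have hGc : AnalyticAt ℝ (fun z => G (c z)) z₀ := hGan.fun_comp hc
  have hw : AnalyticAt ℝ (fun z => (G (c z)).1) z₀ := analyticAt_fst.fun_comp hGc
  have hv : AnalyticAt ℝ (fun z => (G (c z)).2) z₀ := analyticAt_snd.fun_comp hGc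
  refine ⟨d, fun j z => (G (c z)).1 j * ρ ^ (d - j : ℕ),
    fun p => (ρ ^ d)⁻¹ * SummableSeq.eval (p.2 / ρ) (G (c p.1)).2, fun j => ?_, ?_, ?_, ?_⟩
  · refine AnalyticAt.mul ?_ analyticAt_const
    exact ((ContinuousLinearMap.proj (R := ℝ) (φ := fun _ : Fin d => ℝ) j).analyticAt _).fun_comp hw
  · refine analyticAt_const.mul (SummableSeq.analyticAt_eval_apply ?_ (by simp) ?_)
    · exact analyticAt_snd.div_const
    · exact AnalyticAt.fun_comp (g := fun z => (G (c z)).2) (f := Prod.fst) hv analyticAt_fst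
  · simp [hGv, SummableSeq.eval_zero, hv₀0, hρ.ne']
  · rw [nhds_prod_eq]
    filter_upwards [(hfc.and (hc.continuousAt.eventually hGr)).prod_mk h1] with p hp
    obtain ⟨⟨hp1, hp2⟩, hp3⟩ := hp
    have h2 := hp1 _ hp3
    rw [mul_div_cancel₀ _ hρ.ne', ← hp2, SummableSeq.eval_weierstrassMul hp3] at h2
    rw [show f p = f (p.1, p.2) from rfl, h2]
    have h3 : ∀ j : Fin d, (G (c p.1)).1 j * (p.2 / ρ) ^ (j : ℕ) =
        (ρ ^ d)⁻¹ * ((G (c p.1)).1 j * ρ ^ (d - j : ℕ) * p.2 ^ (j : ℕ)) := fun j => by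
      have : ρ ^ d = ρ ^ (d - j : ℕ) * ρ ^ (j : ℕ) := by
        rw [← pow_add, Nat.sub_add_cancel j.2.le]
      rw [this, div_pow]
      field_simp
    rw [Finset.sum_congr rfl fun j _ => h3 j, ← Finset.mul_sum, div_pow]
    field_simp

end WeierstrassDivisionTheory

section SubdiscriminantTheory

/-- The sum over all `k`-element sets of indices of the products of the differences of the
corresponding entries. -/
noncomputable def subDiscr {R : Type*} [CommRing R] {d : ℕ} (k : ℕ) (z : Fin d → R) : R :=
  ∑ J ∈ Finset.powersetCard k Finset.univ, ∏ p ∈ J.offDiag, (z p.1 - z p.2)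

theorem map_subDiscr {R S : Type*} [CommRing R] [CommRing S] {d : ℕ} (φ : R →+* S) (k : ℕ)
    (z : Fin d → R) : φ (subDiscr k z) = subDiscr k fun i => φ (z i) := by
  simp [subDiscr]

theorem subDiscr_comp_equiv {R : Type*} [CommRing R] {d : ℕ} (k : ℕ) (z : Fin d → R)
    (e : Equiv.Perm (Fin d)) : subDiscr k (fun i => z (e i)) = subDiscr k z := by
  refine Finset.sum_bij (fun J _ => J.map e.toEmbedding) ?_ ?_ ?_ ?_
  · intro J hJ
    simpa [Finset.mem_powersetCard] using hJ
  · intro J _ K _ h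
    exact Finset.map_injective _ h
  · intro K hK
    refine ⟨K.map e.symm.toEmbedding, ?_, ?_⟩
    · simpa [Finset.mem_powersetCard] using hK
    · ext i
      simp
  · intro J _
    refine Finset.prod_bij (fun p _ => (e p.1, e p.2)) ?_ ?_ ?_ ?_
    · intro p hp
      simpa [Finset.mem_offDiag] using hp
    · intro p _ q _ h
      simpa [Prod.ext_iff] using h
    · intro q hq
      refine ⟨(e.symm q.1, e.symm q.2), ?_, by simp⟩
      simp only [Finset.mem_offDiag, Finset.mem_map_equiv] at hq ⊢
      exact ⟨hq.1, hq.2.1, fun h => hq.2.2 (e.symm.injective h)⟩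
    · intro p _
      rfl

theorem subDiscr_ne_zero {K : Type*} [Field K] [CharZero K] [DecidableEq K] {d : ℕ}
    (z : Fin d → K) : subDiscr (Finset.univ.image z).card z ≠ 0 := by
  classical
  set S := Finset.univ.image z with hS
  set c := ∏ q ∈ S.offDiag, (q.1 - q.2) with hc
  have hc0 : c ≠ 0 := Finset.prod_ne_zero_iff.2 fun q hq => by
    simpa [sub_eq_zero] using (Finset.mem_offDiag.1 hq).2.2
  have hterm : ∀ J ∈ Finset.powersetCard S.card (Finset.univ : Finset (Fin d)),
      ∏ p ∈ J.offDiag, (z p.1 - z p.2) = if Set.InjOn z J then c else 0 := by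
    intro J hJ
    have hJc := (Finset.mem_powersetCard.1 hJ).2
    split_ifs with hinj
    · have himg : J.image z = S :=
        Finset.eq_of_subset_of_card_le (Finset.image_subset_image (Finset.subset_univ _))
          (by rw [Finset.card_image_of_injOn hinj, hJc])
      refine Finset.prod_bij (fun p _ => (z p.1, z p.2)) ?_ ?_ ?_ ?_
      · intro p hp
        rw [Finset.mem_offDiag] at hp ⊢
        refine ⟨?_, ?_, fun h => hp.2.2 (hinj hp.1 hp.2.1 h)⟩
        · rw [← himg]
          exact Finset.mem_image_of_mem _ hp.1
        · rw [← himg]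
          exact Finset.mem_image_of_mem _ hp.2.1
      · intro p hp q hq h
        rw [Finset.mem_offDiag] at hp hq
        rw [Prod.ext_iff] at h
        exact Prod.ext (hinj hp.1 hq.1 h.1) (hinj hp.2.1 hq.2.1 h.2)
      · intro q hq
        rw [Finset.mem_offDiag, ← himg] at hq
        obtain ⟨a, ha, ha'⟩ := Finset.mem_image.1 hq.1
        obtain ⟨b, hb, hb'⟩ := Finset.mem_image.1 hq.2.1
        refine ⟨(a, b), Finset.mem_offDiag.2 ⟨ha, hb, ?_⟩, Prod.ext ha' hb'⟩
        intro hab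
        exact hq.2.2 (ha'.symm.trans ((congrArg z hab).trans hb'))
      · intro p _
        rfl
    · simp only [Set.InjOn, not_forall] at hinj
      obtain ⟨a, ha, b, hb, hab, hne⟩ := hinj
      exact Finset.prod_eq_zero (i := (a, b)) (Finset.mem_offDiag.2 ⟨ha, hb, hne⟩)
        (sub_eq_zero.2 hab)
  rw [subDiscr, Finset.sum_congr rfl hterm, ← Finset.sum_filter, Finset.sum_const, nsmul_eq_mul]
  refine mul_ne_zero ?_ hc0
  rw [Nat.cast_ne_zero, Finset.card_ne_zero]
  obtain ⟨u, -, hinj, himg⟩ := Finset.exists_subset_injOn_image_eq_of_surjOn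
    (f := z) (Set.univ) S (by
      intro y hy
      obtain ⟨a, -, ha⟩ := Finset.mem_image.1 hy
      exact ⟨a, trivial, ha⟩)
  refine ⟨u, Finset.mem_filter.2 ⟨Finset.mem_powersetCard.2 ⟨Finset.subset_univ _, ?_⟩, hinj⟩⟩
  rw [← himg, Finset.card_image_of_injOn hinj]

open Polynomial in
/-- The sums `subDiscr` of the roots of a monic real polynomial are polynomials in its
coefficients. -/
theorem exists_eval_coeff_eq_subDiscr (d k : ℕ) : ∃ Q : MvPolynomial (Fin d) ℝ,
    ∀ (p : ℝ[X]) (z : Fin d → ℂ), p.map (algebraMap ℝ ℂ) = ∏ i, (X - C (z i)) →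
      subDiscr k z = ((MvPolynomial.eval (fun j : Fin d => p.coeff j) Q : ℝ) : ℂ) := by
  have hsymm : (subDiscr k (MvPolynomial.X : Fin d → MvPolynomial (Fin d) ℝ)).IsSymmetric := by
    intro e
    have := map_subDiscr (MvPolynomial.rename (R := ℝ) e).toRingHom k MvPolynomial.X
    refine this.trans ?_
    rw [← subDiscr_comp_equiv k MvPolynomial.X e]
    simp
  obtain ⟨Q, hQ⟩ := MvPolynomial.esymmAlgHom_surjective (σ := Fin d) (n := d) ℝ (by simp)
    ⟨_, hsymm⟩
  have hQ' : MvPolynomial.aeval (fun i : Fin d => MvPolynomial.esymm (Fin d) ℝ (i + 1)) Q =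
      subDiscr k MvPolynomial.X := by
    rw [← MvPolynomial.esymmAlgHom_apply, hQ]
  refine ⟨MvPolynomial.aeval (fun i : Fin d =>
    (-1 : MvPolynomial (Fin d) ℝ) ^ ((i : ℕ) + 1) * MvPolynomial.X i.rev) Q, fun p z hp => ?_⟩
  have h1 : subDiscr k z = MvPolynomial.aeval z
      (subDiscr k (MvPolynomial.X : Fin d → MvPolynomial (Fin d) ℝ)) := by
    have := map_subDiscr (MvPolynomial.aeval (R := ℝ) z).toRingHom k MvPolynomial.X
    refine Eq.trans ?_ this.symm
    simp
  have hcoe : ((MvPolynomial.eval (fun j : Fin d => p.coeff j) (MvPolynomial.aeval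
      (fun i : Fin d => (-1 : MvPolynomial (Fin d) ℝ) ^ ((i : ℕ) + 1) * MvPolynomial.X i.rev) Q)
      : ℝ) : ℂ) = MvPolynomial.aeval
        (fun i : Fin d => (-1 : ℂ) ^ ((i : ℕ) + 1) * (p.coeff i.rev : ℂ)) Q := by
    rw [← MvPolynomial.coe_aeval_eq_eval]
    change algebraMap ℝ ℂ (MvPolynomial.aeval _ _) = _
    rw [← MvPolynomial.aeval_algebraMap_apply, ← AlgHom.comp_apply, MvPolynomial.comp_aeval]
    congr 2
    funext i
    simp
  rw [h1, ← hQ', hcoe, ← AlgHom.comp_apply, MvPolynomial.comp_aeval]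
  congr 2
  funext i
  rw [MvPolynomial.aeval_esymm_eq_multiset_esymm]
  have hp' : (p.map (algebraMap ℝ ℂ)).coeff i.rev = ((p.coeff i.rev : ℝ) : ℂ) := coeff_map _ _
  have h2 : (∏ i, (X - C (z i))) =
      (((Finset.univ.val.map z).map fun t => X - C t).prod : ℂ[X]) := by
    rw [Multiset.map_map]; rfl
  rw [← hp', hp, h2, Multiset.prod_X_sub_C_coeff _ (by simp)]
  have h3 : Multiset.card (Finset.univ.val.map z) - (i.rev : ℕ) = i + 1 := by
    simp [Fin.val_rev]
    omega
  rw [h3, ← mul_assoc, ← mul_pow]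
  simp

open Polynomial in
theorem exists_roots_of_monic {p : ℝ[X]} (hp : p.Monic) {d : ℕ} (hd : p.natDegree = d) :
    ∃ z : Fin d → ℂ, p.map (algebraMap ℝ ℂ) = ∏ i, (X - C (z i)) := by
  have h1 := IsAlgClosed.splits (p.map (algebraMap ℝ ℂ))
  have hm : (p.map (algebraMap ℝ ℂ)).Monic := hp.map _
  have hcard : Multiset.card (p.map (algebraMap ℝ ℂ)).roots = d := by
    rw [← h1.natDegree_eq_card_roots, natDegree_map, hd]
  have h2 := h1.eq_prod_roots_of_monic hm
  set s := (p.map (algebraMap ℝ ℂ)).roots with hs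
  refine ⟨fun i => s.toList.get (i.cast (by simp [hcard])), ?_⟩
  conv_lhs => rw [h2, ← s.coe_toList, Multiset.map_coe, Multiset.prod_coe,
    ← Fin.prod_univ_fun_getElem]
  have hl : d = s.toList.length := by simp [hcard]
  exact (Fintype.prod_equiv (finCongr hl) (fun i : Fin d => X - C (s.toList.get (i.cast hl)))
    (fun i : Fin s.toList.length => X - C s.toList[i]) fun i => rfl).symm

end SubdiscriminantTheory

section FlatTheory

variable {ι : Type*}

/-- A family is flat along a filter, with respect to a scale `t`, if it is bounded by every power
of `t`. -/
def Flat {E : Type*} [Norm E] (l : Filter ι) (t : ι → ℝ) (z : ι → E) : Prop :=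
  ∀ M : ℕ, ∀ᶠ k in l, ‖z k‖ ≤ t k ^ M

namespace Flat

section

variable {E F : Type*} [SeminormedAddCommGroup E] [SeminormedAddCommGroup F] {l : Filter ι}
  {t : ι → ℝ} {z w : ι → E}

theorem of_norm_le_mul {y : ι → F} (ht : Tendsto t l (𝓝[>] 0)) (hz : Flat l t z) (C : ℝ)
    (h : ∀ᶠ k in l, ‖y k‖ ≤ C * ‖z k‖) : Flat l t y := fun M => by
  have h0 : ∀ᶠ k in l, 0 < t k := ht.eventually self_mem_nhdsWithin
  have h1 : Tendsto (fun k => C * t k) l (𝓝 (C * 0)) :=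
    ((tendsto_nhdsWithin_iff.1 ht).1).const_mul C
  have h2 : ∀ᶠ k in l, C * t k < 1 := h1.eventually_lt_const (by simp)
  have h3 : ∀ᶠ k in l, 0 ≤ C ∨ C < 0 := Eventually.of_forall fun _ => le_or_gt 0 C
  filter_upwards [h, hz (M + 1), h0, h2, h3] with k hk hz h0 h2 h3
  refine hk.trans ?_
  rcases h3 with h3 | h3
  · calc C * ‖z k‖ ≤ C * t k ^ (M + 1) := by gcongr
      _ = (C * t k) * t k ^ M := by ring
      _ ≤ 1 * t k ^ M := by gcongr
      _ = _ := one_mul _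
  · exact (mul_nonpos_of_nonpos_of_nonneg h3.le (norm_nonneg _)).trans (by positivity)

theorem of_norm_le {y : ι → F} (hz : Flat l t z) (h : ∀ᶠ k in l, ‖y k‖ ≤ ‖z k‖) : Flat l t y :=
  fun M => by
    filter_upwards [h, hz M] with k hk hz using hk.trans hz

theorem congr' (hz : Flat l t z) (h : ∀ᶠ k in l, z k = w k) : Flat l t w :=
  hz.of_norm_le (h.mono fun k hk => by rw [hk])

theorem add (ht : Tendsto t l (𝓝[>] 0)) (hz : Flat l t z) (hw : Flat l t w) :
    Flat l t fun k => z k + w k := fun M => by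
  have h0 : ∀ᶠ k in l, 0 < t k := ht.eventually self_mem_nhdsWithin
  have h2 : ∀ᶠ k in l, t k < 1 / 2 :=
    ((tendsto_nhdsWithin_iff.1 ht).1).eventually_lt_const (by norm_num)
  filter_upwards [hz (M + 1), hw (M + 1), h0, h2] with k hz hw h0 h2
  have : 0 < t k ^ M := by positivity
  calc ‖z k + w k‖ ≤ ‖z k‖ + ‖w k‖ := norm_add_le _ _
    _ ≤ t k ^ M * t k + t k ^ M * t k := by
      rw [pow_succ] at hz hw
      gcongr
    _ ≤ t k ^ M := by nlinarith

theorem neg (hz : Flat l t z) : Flat l t fun k => -z k :=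
  hz.of_norm_le (Eventually.of_forall fun _ => (norm_neg _).le)

theorem sub (ht : Tendsto t l (𝓝[>] 0)) (hz : Flat l t z) (hw : Flat l t w) :
    Flat l t fun k => z k - w k := by
  simpa [sub_eq_add_neg] using hz.add ht hw.neg

theorem sub_comm (hz : Flat l t fun k => z k - w k) : Flat l t fun k => w k - z k :=
  hz.of_norm_le (Eventually.of_forall fun _ => (norm_sub_rev _ _).le)

theorem sub_trans {y : ι → E} (ht : Tendsto t l (𝓝[>] 0)) (hz : Flat l t fun k => z k - w k)
    (hw : Flat l t fun k => w k - y k) : Flat l t fun k => z k - y k := by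
  simpa using hz.add ht hw

theorem zero (ht : Tendsto t l (𝓝[>] 0)) : Flat l t fun _ => (0 : E) := fun M => by
  filter_upwards [ht.eventually self_mem_nhdsWithin] with k hk
  rw [norm_zero]
  exact pow_nonneg (le_of_lt hk) M

theorem sum {α : Type*} (s : Finset α) {f : α → ι → E} (ht : Tendsto t l (𝓝[>] 0))
    (hf : ∀ a ∈ s, Flat l t (f a)) : Flat l t fun k => ∑ a ∈ s, f a k := by
  classical
  induction s using Finset.induction_on with
  | empty => simpa using zero ht
  | insert a s ha ih =>
    simp only [Finset.sum_insert ha]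
    exact (hf a (by simp)).add ht (ih fun b hb => hf b (by simp [hb]))

theorem tendsto_zero (ht : Tendsto t l (𝓝[>] 0)) (hz : Flat l t z) : Tendsto z l (𝓝 0) := by
  refine squeeze_zero_norm' (hz 1) ?_
  simpa using (tendsto_nhdsWithin_iff.1 ht).1

end

section Field

variable {K : Type*} [NormedField K] {l : Filter ι} {t : ι → ℝ}

theorem bdd_mul {b z : ι → K} (ht : Tendsto t l (𝓝[>] 0)) (hz : Flat l t z) {C : ℝ}
    (hb : ∀ᶠ k in l, ‖b k‖ ≤ C) : Flat l t fun k => b k * z k :=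
  hz.of_norm_le_mul ht C (hb.mono fun k hk => by
    rw [norm_mul]
    gcongr)

theorem exists_of_prod {α : Type*} {𝒰 : Ultrafilter ι} (ht : Tendsto t 𝒰 (𝓝[>] 0)) (s : Finset α)
    {f : α → ι → K} (hf : Flat 𝒰 t fun k => ∏ a ∈ s, f a k) : ∃ a ∈ s, Flat 𝒰 t (f a) := by
  by_contra! hcon
  have h0 : ∀ᶠ k in (𝒰 : Filter ι), 0 < t k := ht.eventually self_mem_nhdsWithin
  have h1 : ∀ᶠ k in (𝒰 : Filter ι), t k < 1 :=
    ((tendsto_nhdsWithin_iff.1 ht).1).eventually_lt_const one_pos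
  have hM : ∀ a ∈ s, ∃ M : ℕ, ∀ᶠ k in (𝒰 : Filter ι), t k ^ M < ‖f a k‖ := fun a ha => by
    have := hcon a ha
    simp only [Flat, not_forall] at this
    obtain ⟨M, hM⟩ := this
    refine ⟨M, ?_⟩
    simpa using Ultrafilter.eventually_not.2 hM
  choose! M hM using hM
  have hall : ∀ᶠ k in (𝒰 : Filter ι), ∀ a ∈ s, t k ^ M a < ‖f a k‖ := by
    rw [Filter.eventually_all_finset]
    exact hM
  obtain ⟨k, hall, hf, h0, h1⟩ := (hall.and ((hf (∑ a ∈ s, M a + 1)).and (h0.and h1))).exists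
  rw [norm_prod] at hf
  have h2 : ∏ a ∈ s, t k ^ M a ≤ ∏ a ∈ s, ‖f a k‖ :=
    Finset.prod_le_prod (fun a _ => by positivity) fun a ha => (hall a ha).le
  rw [Finset.prod_pow_eq_pow_sum] at h2
  have h3 := pow_lt_pow_right_of_lt_one₀ h0 h1 (Nat.lt_succ_self (∑ a ∈ s, M a))
  exact absurd (h2.trans hf) (not_le.2 h3)

theorem of_prod_of_mem {α : Type*} (ht : Tendsto t l (𝓝[>] 0)) {s : Finset α}
    {f : α → ι → K} {a : α} (ha : a ∈ s) (hf : Flat l t (f a)) {C : ℝ}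
    (hC : ∀ᶠ k in l, ∀ b ∈ s, ‖f b k‖ ≤ C) : Flat l t fun k => ∏ b ∈ s, f b k := by
  classical
  refine hf.of_norm_le_mul ht (C ^ (s.erase a).card) ?_
  filter_upwards [hC] with k hk
  rw [← Finset.mul_prod_erase s _ ha, norm_mul, mul_comm, norm_prod]
  gcongr
  refine (Finset.prod_le_prod (fun _ _ => norm_nonneg _)
    fun b hb => hk b (Finset.mem_of_mem_erase hb)).trans_eq ?_
  simp

end Field

/-- Analytic maps preserve flatness of differences. -/
theorem comp_sub {E F : Type*} [NormedAddCommGroup E] [NormedSpace ℝ E] [NormedAddCommGroup F]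
    [NormedSpace ℝ F] [CompleteSpace F] {l : Filter ι} {t : ι → ℝ} {x y : ι → E} {f : E → F}
    {x₀ : E} (ht : Tendsto t l (𝓝[>] 0)) (hf : AnalyticAt ℝ f x₀) (hx : Tendsto x l (𝓝 x₀))
    (hxy : Flat l t fun k => y k - x k) : Flat l t fun k => f (y k) - f (x k) := by
  have hy : Tendsto y l (𝓝 x₀) := by simpa using hx.add (hxy.tendsto_zero ht)
  have h := (hf.hasStrictFDerivAt.isBigO_sub).comp_tendsto (hy.prodMk_nhds hx)
  obtain ⟨C, hC⟩ := h.bound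
  exact hxy.of_norm_le_mul ht C hC

end Flat

open Polynomial in
theorem Polynomial.norm_root_le {p : ℝ[X]} (hp : p.Monic) {C : ℝ} (hC : ∀ j, |p.coeff j| ≤ C)
    {ζ : ℂ} (hζ : aeval ζ p = 0) : ‖ζ‖ ≤ 1 + p.natDegree * C := by
  have hC0 : 0 ≤ C := (abs_nonneg _).trans (hC 0)
  rcases le_or_gt ‖ζ‖ 1 with h | h
  · have : 0 ≤ p.natDegree * C := by positivity
    linarith
  have hs : ζ ^ p.natDegree = -∑ j ∈ Finset.range p.natDegree, (p.coeff j : ℂ) * ζ ^ j := by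
    rw [aeval_eq_sum_range, Finset.sum_range_succ, hp.coeff_natDegree, one_smul] at hζ
    rw [eq_neg_iff_add_eq_zero, add_comm, ← hζ]
    simp
  have hd : p.natDegree ≠ 0 := by
    intro hd
    rw [hd] at hs
    simp at hs
  obtain ⟨d, hd⟩ := Nat.exists_eq_succ_of_ne_zero hd
  have h1 : ‖ζ‖ ^ (d + 1) ≤ ((d + 1 : ℕ) * C) * ‖ζ‖ ^ d := by
    rw [← norm_pow, ← Nat.succ_eq_add_one, ← hd, hs, norm_neg, hd]
    refine (norm_sum_le _ _).trans ?_
    have : ∀ j ∈ Finset.range (d + 1), ‖(p.coeff j : ℂ) * ζ ^ j‖ ≤ C * ‖ζ‖ ^ d := fun j hj => by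
      rw [norm_mul, norm_pow, Complex.norm_real, Real.norm_eq_abs]
      gcongr
      · exact hC j
      · exact h.le
      · simpa [Nat.lt_succ_iff] using hj
    refine (Finset.sum_le_sum this).trans_eq ?_
    simp
    ring
  rw [pow_succ, mul_comm] at h1
  have := le_of_mul_le_mul_right h1 (by positivity)
  rw [hd]
  linarith

open Polynomial in
/-- If the discriminants of a family of monic real polynomials `p'` vanish whenever the
corresponding discriminants of a flat perturbation `p` are flat, then roots of `p'` whose
difference is flat coincide. -/
theorem Flat.eventually_eq_roots {𝒰 : Ultrafilter ι} {t : ι → ℝ} (ht : Tendsto t 𝒰 (𝓝[>] 0))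
    {d : ℕ} {p p' : ι → ℝ[X]} (hpm : ∀ k, (p k).Monic) (hpd : ∀ k, (p k).natDegree = d)
    (hpm' : ∀ k, (p' k).Monic) (hpd' : ∀ k, (p' k).natDegree = d)
    {K : ℝ} (hK : ∀ᶠ k in (𝒰 : Filter ι), ∀ j, |(p k).coeff j| ≤ K ∧ |(p' k).coeff j| ≤ K)
    (hpp : ∀ j, Flat 𝒰 t fun k => (p' k).coeff j - (p k).coeff j)
    (Q : ℕ → MvPolynomial (Fin d) ℝ)
    (hQ : ∀ m (p : ℝ[X]) (z : Fin d → ℂ), p.map (algebraMap ℝ ℂ) = ∏ i, (X - C (z i)) →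
      subDiscr m z = ((MvPolynomial.eval (fun j : Fin d => p.coeff j) (Q m) : ℝ) : ℂ))
    (hfl : ∀ m ≤ d, (Flat 𝒰 t fun k => MvPolynomial.eval (fun j : Fin d => (p k).coeff j) (Q m)) →
      ∀ᶠ k in (𝒰 : Filter ι), MvPolynomial.eval (fun j : Fin d => (p' k).coeff j) (Q m) = 0)
    {ζ ζ' : ι → ℂ} (hζ : ∀ᶠ k in (𝒰 : Filter ι), aeval (ζ k) (p' k) = 0)
    (hζ' : ∀ᶠ k in (𝒰 : Filter ι), aeval (ζ' k) (p' k) = 0)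
    (hζζ : Flat 𝒰 t fun k => ζ k - ζ' k) : ∀ᶠ k in (𝒰 : Filter ι), ζ k = ζ' k := by
  classical
  choose z hz using fun k => exists_roots_of_monic (hpm k) (hpd k)
  choose w hw using fun k => exists_roots_of_monic (hpm' k) (hpd' k)
  have haeval : ∀ k (s : ℂ), aeval s (p k) = ∏ i, (s - z k i) := fun k s => by
    rw [← aeval_map_algebraMap ℂ, hz, map_prod]
    simp
  have haeval' : ∀ k (s : ℂ), aeval s (p' k) = ∏ i, (s - w k i) := fun k s => by
    rw [← aeval_map_algebraMap ℂ, hw, map_prod]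
    simp
  have hzroot : ∀ k i, aeval (z k i) (p k) = 0 := fun k i => by
    rw [haeval]
    exact Finset.prod_eq_zero (Finset.mem_univ i) (sub_self _)
  set B := 1 + d * K with hB
  have hzB : ∀ᶠ k in (𝒰 : Filter ι), ∀ i, ‖z k i‖ ≤ B := by
    filter_upwards [hK] with k hk i
    have := norm_root_le (hpm k) (fun j => (hk j).1) (hzroot k i)
    rwa [hpd k] at this
  -- a maximal set of indices of pairwise separated roots
  let good : Finset (Fin d) → Prop := fun I =>
    ∀ i ∈ I, ∀ j ∈ I, i ≠ j → ¬ Flat 𝒰 t fun k => z k i - z k j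
  obtain ⟨I, hI, hmax⟩ := Finset.exists_max_image (Finset.univ.filter good) Finset.card
    ⟨∅, by simp [good]⟩
  replace hI : good I := (Finset.mem_filter.1 hI).2
  have hD : ∀ m ≤ d, I.card < m → ∀ᶠ k in (𝒰 : Filter ι), subDiscr m (w k) = 0 := by
    intro m hmd hm
    have hflat : Flat 𝒰 t fun k => subDiscr m (z k) := by
      refine Flat.sum _ ht fun J hJ => ?_
      have hJ' : ¬ good J := fun hg => by
        have := hmax J (by simp [hg])
        rw [(Finset.mem_powersetCard.1 hJ).2] at this
        omega
      simp only [good, not_forall, not_not] at hJ'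
      obtain ⟨a, ha, b, hb, hab, hfl⟩ := hJ'
      refine Flat.of_prod_of_mem (f := fun (p : Fin d × Fin d) k => z k p.1 - z k p.2) (a := (a, b))
        (C := B + B) ht (Finset.mem_offDiag.2 ⟨ha, hb, hab⟩) hfl ?_
      filter_upwards [hzB] with k hk q _
      exact (norm_sub_le _ _).trans (add_le_add (hk _) (hk _))
    have h2 : Flat 𝒰 t fun k => MvPolynomial.eval (fun j : Fin d => (p k).coeff j) (Q m) :=
      hflat.of_norm_le (Eventually.of_forall fun k => by
        rw [hQ m (p k) (z k) (hz k), Complex.norm_real])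
    filter_upwards [hfl m hmd h2] with k hk
    rw [hQ m (p' k) (w k) (hw k), hk, Complex.ofReal_zero]
  have hcard : ∀ᶠ k in (𝒰 : Filter ι), (Finset.univ.image (w k)).card ≤ I.card := by
    have : ∀ᶠ k in (𝒰 : Filter ι), ∀ m ∈ Finset.range (d + 1), I.card < m →
        subDiscr m (w k) = 0 := by
      rw [Filter.eventually_all_finset]
      intro m hm
      by_cases h : I.card < m
      · filter_upwards [hD m (by simpa [Nat.lt_succ_iff] using hm) h] with k hk _ using hk
      · exact Eventually.of_forall fun k h' => absurd h' h
    filter_upwards [this] with k hk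
    by_contra! hlt
    refine subDiscr_ne_zero (w k) (hk _ ?_ hlt)
    rw [Finset.mem_range, Nat.lt_succ_iff]
    exact Finset.card_image_le.trans (by simp)
  have hnear : ∀ i, ∃ j, Flat 𝒰 t fun k => z k i - w k j := by
    intro i
    have h1 : Flat 𝒰 t fun k => ∏ j, (z k i - w k j) := by
      have h2 : Flat 𝒰 t fun k => ∑ j ∈ Finset.range (d + 1),
          (z k i) ^ j * (((p' k).coeff j - (p k).coeff j : ℝ) : ℂ) := by
        refine Flat.sum _ ht fun j _ => Flat.bdd_mul (C := B ^ j) ht ?_ ?_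
        · exact (hpp j).of_norm_le (Eventually.of_forall fun k => by rw [Complex.norm_real])
        · filter_upwards [hzB] with k hk
          rw [norm_pow]
          gcongr
          exact hk i
      refine h2.congr' (Eventually.of_forall fun k => ?_)
      have h3 : aeval (z k i) (p' k) - aeval (z k i) (p k) = ∏ j, (z k i - w k j) := by
        rw [hzroot, sub_zero, haeval']
      rw [← h3, aeval_eq_sum_range, aeval_eq_sum_range, hpd, hpd', ← Finset.sum_sub_distrib]
      refine Finset.sum_congr rfl fun j _ => ?_
      rw [← sub_smul, mul_comm]
      simp
    obtain ⟨j, -, hj⟩ := Flat.exists_of_prod (f := fun j k => z k i - w k j) ht Finset.univ h1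
    exact ⟨j, hj⟩
  choose φ hφ using hnear
  have hsep : ∀ i ∈ I, ∀ j ∈ I, (Flat 𝒰 t fun k => w k (φ i) - w k (φ j)) → i = j := by
    intro i hi j hj h
    by_contra hij
    exact hI i hi j hj hij (((hφ i).sub_trans ht h).sub_trans ht (hφ j).sub_comm)
  have hinj : ∀ᶠ k in (𝒰 : Filter ι), Set.InjOn (fun i => w k (φ i)) I := by
    have : ∀ᶠ k in (𝒰 : Filter ι), ∀ q ∈ I.offDiag, w k (φ q.1) ≠ w k (φ q.2) := by
      rw [Filter.eventually_all_finset]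
      intro q hq
      rw [Finset.mem_offDiag] at hq
      refine Ultrafilter.eventually_not.2 fun h => hq.2.2 (hsep _ hq.1 _ hq.2.1 ?_)
      exact (Flat.zero ht).congr' (h.mono fun k hk => by rw [hk, sub_self])
    filter_upwards [this] with k hk i hi j hj hij
    by_contra hne
    exact hk (i, j) (Finset.mem_offDiag.2 ⟨hi, hj, hne⟩) hij
  have hroot : ∀ ξ : ι → ℂ, (∀ᶠ k in (𝒰 : Filter ι), aeval (ξ k) (p' k) = 0) →
      ∃ i ∈ I, ∀ᶠ k in (𝒰 : Filter ι), ξ k = w k (φ i) := by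
    intro ξ hξ
    have : ∀ᶠ k in (𝒰 : Filter ι), ∃ i ∈ I, ξ k = w k (φ i) := by
      filter_upwards [hξ, hcard, hinj] with k hξ hcard hinj
      have himg : I.image (fun i => w k (φ i)) = Finset.univ.image (w k) := by
        refine Finset.eq_of_subset_of_card_le ?_ ?_
        · intro y hy
          obtain ⟨i, -, rfl⟩ := Finset.mem_image.1 hy
          exact Finset.mem_image_of_mem _ (Finset.mem_univ _)
        · rwa [Finset.card_image_of_injOn hinj]
      rw [haeval', Finset.prod_eq_zero_iff] at hξ
      obtain ⟨j, -, hj⟩ := hξ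
      have : ξ k ∈ I.image (fun i => w k (φ i)) := by
        rw [himg, sub_eq_zero.1 hj]
        exact Finset.mem_image_of_mem _ (Finset.mem_univ _)
      obtain ⟨i, hi, hi'⟩ := Finset.mem_image.1 this
      exact ⟨i, hi, hi'.symm⟩
    by_contra! hcon
    have h2 : ∀ᶠ k in (𝒰 : Filter ι), ∀ i ∈ I, ¬ ξ k = w k (φ i) := by
      rw [Filter.eventually_all_finset]
      intro i hi
      exact hcon i hi
    obtain ⟨k, ⟨i, hi, h⟩, h'⟩ := (this.and h2).exists
    exact h' i hi h
  obtain ⟨i, hi, hi'⟩ := hroot ζ hζ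
  obtain ⟨j, hj, hj'⟩ := hroot ζ' hζ'
  have hij : i = j := hsep i hi j hj (hζζ.congr' (by
    filter_upwards [hi', hj'] with k h1 h2
    rw [h1, h2]))
  subst hij
  filter_upwards [hi', hj'] with k h1 h2
  rw [h1, h2]

end FlatTheory

section Germs

variable {E : Type*} [NormedAddCommGroup E] [NormedSpace ℝ E]

theorem AnalyticOnNhd.not_eventually_eq_zero_of_mem_ball {f : E → ℝ} {x₀ : E} {ε : ℝ}
    (hf : AnalyticOnNhd ℝ f (ball x₀ ε)) (hne : ¬ ∀ᶠ x in 𝓝 x₀, f x = 0) {y : E}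
    (hy : y ∈ ball x₀ ε) : ¬ ∀ᶠ x in 𝓝 y, f x = 0 := fun h => hne <| by
  have hε : 0 < ε := pos_of_mem_ball hy
  have := hf.eqOn_zero_of_preconnected_of_eventuallyEq_zero (convex_ball x₀ ε).isPreconnected hy h
  filter_upwards [ball_mem_nhds x₀ hε] with x hx using this hx

/-- Finitely many nonzero analytic germs are simultaneously nonzero at points arbitrarily close
to the base point. -/
theorem AnalyticAt.frequently_forall_ne_zero {α : Type*} (s : Finset α) {f : α → E → ℝ} {x₀ : E}
    (hf : ∀ i ∈ s, AnalyticAt ℝ (f i) x₀) (hne : ∀ i ∈ s, ¬ ∀ᶠ x in 𝓝 x₀, f i x = 0) :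
    ∃ᶠ x in 𝓝 x₀, ∀ i ∈ s, f i x ≠ 0 := by
  classical
  rw [frequently_nhds_iff]
  intro U hxU hU
  have hev : ∀ᶠ x in 𝓝 x₀, x ∈ U ∧ ∀ i ∈ s, AnalyticAt ℝ (f i) x := by
    refine (hU.eventually_mem hxU).and ?_
    rw [Filter.eventually_all_finset]
    exact fun i hi => (hf i hi).eventually_analyticAt
  obtain ⟨ε, hε, hball⟩ := Metric.eventually_nhds_iff_ball.1 hev
  have key : ∀ s' ⊆ s, ∃ W : Set E, IsOpen W ∧ W.Nonempty ∧ W ⊆ ball x₀ ε ∧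
      ∀ x ∈ W, ∀ i ∈ s', f i x ≠ 0 := by
    intro s'
    induction s' using Finset.induction_on with
    | empty => exact fun _ => ⟨ball x₀ ε, isOpen_ball, ⟨x₀, mem_ball_self hε⟩, Subset.rfl, by simp⟩
    | insert a s' ha ih =>
      intro hs
      obtain ⟨W, hWo, ⟨y, hy⟩, hWb, hW⟩ := ih fun i hi => hs (Finset.mem_insert_of_mem hi)
      have has : a ∈ s := hs (Finset.mem_insert_self a s')
      have hfa : AnalyticOnNhd ℝ (f a) (ball x₀ ε) := fun x hx => (hball x hx).2 a has
      have h1 := hfa.not_eventually_eq_zero_of_mem_ball (hne a has) (hWb hy)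
      obtain ⟨y', hy'0, hy'W⟩ :=
        ((Filter.not_eventually.1 h1).and_eventually (hWo.eventually_mem hy)).exists
      have hcont : ContinuousOn (f a) W := fun x hx => (hfa x (hWb hx)).continuousAt.continuousWithinAt
      refine ⟨W ∩ f a ⁻¹' {0}ᶜ, hcont.isOpen_inter_preimage hWo isOpen_compl_singleton,
        ⟨y', hy'W, hy'0⟩, inter_subset_left.trans hWb, fun x hx i hi => ?_⟩
      rcases Finset.mem_insert.1 hi with rfl | hi
      · exact hx.2
      · exact hW x hx.1 i hi
  obtain ⟨W, -, ⟨y, hy⟩, hWb, hW⟩ := key s Subset.rfl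
  exact ⟨y, (hball y (hWb hy)).1, hW y hy⟩

/-- Finitely many nonzero analytic germs are simultaneously nonzero along some line. -/
theorem AnalyticAt.exists_direction {α : Type*} (s : Finset α) {f : α → E → ℝ} {x₀ : E}
    (hf : ∀ i ∈ s, AnalyticAt ℝ (f i) x₀) (hne : ∀ i ∈ s, ¬ ∀ᶠ x in 𝓝 x₀, f i x = 0) :
    ∃ w : E, ∀ i ∈ s, ¬ ∀ᶠ u : ℝ in 𝓝 0, f i (x₀ + u • w) = 0 := by
  have hev : ∀ᶠ x in 𝓝 x₀, ∀ i ∈ s, AnalyticAt ℝ (f i) x := by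
    rw [Filter.eventually_all_finset]
    exact fun i hi => (hf i hi).eventually_analyticAt
  obtain ⟨ε, hε, hball⟩ := Metric.eventually_nhds_iff_ball.1 hev
  obtain ⟨y, hy, hyb⟩ := ((frequently_forall_ne_zero s hf hne).and_eventually
    (ball_mem_nhds x₀ hε)).exists
  refine ⟨y - x₀, fun i hi h => hy i hi ?_⟩
  have han : AnalyticOnNhd ℝ (fun u : ℝ => f i (x₀ + u • (y - x₀))) (Icc 0 1) := by
    intro u hu
    refine AnalyticAt.fun_comp (g := f i) (f := fun u : ℝ => x₀ + u • (y - x₀)) ?_ (by fun_prop)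
    refine hball _ ?_ i hi
    rw [mem_ball, dist_eq_norm, add_sub_cancel_left, norm_smul, Real.norm_of_nonneg hu.1]
    rw [dist_eq_norm] at hyb
    exact (mul_le_of_le_one_left (norm_nonneg _) hu.2).trans_lt hyb
  have := han.eqOn_zero_of_preconnected_of_eventuallyEq_zero isPreconnected_Icc
    (left_mem_Icc.2 zero_le_one) h (right_mem_Icc.2 zero_le_one)
  simpa using this

open Polynomial

theorem analyticAt_coeff_mul {p q : E → ℝ[X]} {z₀ : E}
    (hp : ∀ j, AnalyticAt ℝ (fun z => (p z).coeff j) z₀)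
    (hq : ∀ j, AnalyticAt ℝ (fun z => (q z).coeff j) z₀) (j : ℕ) :
    AnalyticAt ℝ (fun z => (p z * q z).coeff j) z₀ := by
  simp only [coeff_mul]
  exact Finset.analyticAt_fun_sum _ fun x _ => (hp x.1).mul (hq x.2)

theorem analyticAt_coeff_prod {α : Type*} (s : Finset α) {p : α → E → ℝ[X]} {z₀ : E}
    (hp : ∀ i j, AnalyticAt ℝ (fun z => (p i z).coeff j) z₀) (j : ℕ) :
    AnalyticAt ℝ (fun z => (∏ i ∈ s, p i z).coeff j) z₀ := by
  classical
  induction s using Finset.induction_on generalizing j with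
  | empty => simpa using analyticAt_const
  | insert a s ha ih =>
    simp only [Finset.prod_insert ha]
    exact analyticAt_coeff_mul (hp a) ih j

/-- The Weierstrass preparation theorem in terms of polynomials with analytic coefficients. -/
theorem AnalyticAt.exists_weierstrass_polynomial {f : E × ℝ → ℝ} {z₀ : E}
    (hf : AnalyticAt ℝ f (z₀, 0)) (hne : ¬ ∀ᶠ s in 𝓝 (0 : ℝ), f (z₀, s) = 0) :
    ∃ (d : ℕ) (W : E → ℝ[X]) (u : E × ℝ → ℝ), (∀ z, (W z).Monic) ∧ (∀ z, (W z).natDegree = d) ∧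
      (∀ j, AnalyticAt ℝ (fun z => (W z).coeff j) z₀) ∧
      AnalyticAt ℝ u (z₀, 0) ∧ u (z₀, 0) ≠ 0 ∧
      ∀ᶠ p in 𝓝 (z₀, 0), f p = u p * (W p.1).eval p.2 := by
  obtain ⟨d, a, u, ha, hu, hu0, hfu⟩ := hf.exists_weierstrass hne
  have hdeg : ∀ z, (∑ j : Fin d, C (a j z) * X ^ (j : ℕ)).degree < (d : WithBot ℕ) := fun z => by
    refine (degree_sum_le _ _).trans_lt ?_
    refine (Finset.sup_lt_iff (WithBot.bot_lt_coe d)).2 fun j _ => ?_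
    exact (degree_C_mul_X_pow_le _ _).trans_lt (WithBot.coe_lt_coe.2 j.2)
  refine ⟨d, fun z => X ^ d + ∑ j : Fin d, C (a j z) * X ^ (j : ℕ), u, fun z => ?_, fun z => ?_,
    fun j => ?_, hu, hu0, ?_⟩
  · exact monic_X_pow_add (hdeg z)
  · rw [natDegree_add_eq_left_of_degree_lt (by rw [degree_X_pow]; exact hdeg z), natDegree_X_pow]
  · simp only [coeff_add, finsetSum_coeff, coeff_C_mul, coeff_X_pow]
    exact analyticAt_const.add (Finset.analyticAt_fun_sum _ fun i _ => (ha i).mul analyticAt_const)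
  · filter_upwards [hfu] with p hp
    rw [hp]
    simp [eval_finsetSum]

end Germs

section Lift

open Polynomial

variable {ι : Type*}

theorem Flat.prodMk {E F : Type*} [SeminormedAddCommGroup E] [SeminormedAddCommGroup F]
    {l : Filter ι} {t : ι → ℝ} {z : ι → E} {w : ι → F} (hz : Flat l t z) (hw : Flat l t w) :
    Flat l t fun k => (z k, w k) := fun M => by
  filter_upwards [hz M, hw M] with k h1 h2 using max_le h1 h2

variable {𝒰 : Ultrafilter ι} {t t' : ι → ℝ}

theorem exists_flat_lift_of_forall_ne_zero (ht : Tendsto t 𝒰 (𝓝[>] 0))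
    (htt : Flat 𝒰 t fun k => t' k - t k)
    {E : Type*} [NormedAddCommGroup E] [NormedSpace ℝ E] {α : Type*} [Finite α]
    (H : ∀ (s : Set α) (f : s → E × ℝ → ℝ), (∀ i, AnalyticAt ℝ (f i) (0, 0)) →
      (∀ i, ¬ ∀ᶠ z in 𝓝 0, f i (z, 0) = 0) →
      ∀ x : ι → E, Tendsto x 𝒰 (𝓝 0) → (∀ i, Flat 𝒰 t fun k => f i (x k, t k)) →
      ∃ y : ι → E, Flat 𝒰 t (fun k => y k - x k) ∧ ∀ i, ∀ᶠ k in (𝒰 : Filter ι),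
        f i (y k, t' k) = 0)
    (f : α → E × ℝ → ℝ) (hf : ∀ i, AnalyticAt ℝ (f i) (0, 0)) (x : ι → E)
    (hx : Tendsto x 𝒰 (𝓝 0)) :
    ∃ y : ι → E, Flat 𝒰 t (fun k => y k - x k) ∧ ∀ i, (Flat 𝒰 t fun k => f i (x k, t k)) →
      ∀ᶠ k in (𝒰 : Filter ι), f i (y k, t' k) = 0 := by
  have ht0 : Tendsto t 𝒰 (𝓝 0) := (tendsto_nhdsWithin_iff.1 ht).1
  have hpos : ∀ᶠ k in (𝒰 : Filter ι), 0 < t k := ht.eventually self_mem_nhdsWithin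
  have ht'0 : Tendsto t' 𝒰 (𝓝 0) := by simpa using ht0.add (htt.tendsto_zero ht)
  let s : Set α := {i | (¬ ∀ᶠ p in 𝓝 (0, 0), f i p = 0) ∧ Flat 𝒰 t fun k => f i (x k, t k)}
  have h := fun i : s => (hf i).exists_eq_pow_mul i.2.1
  choose a f' hf' hne hff' using h
  obtain ⟨y, hyx, hy⟩ := H s f' hf' hne x hx (fun i M => by
    have h1 := (hx.prodMk_nhds ht0).eventually (hff' i)
    filter_upwards [h1, i.2.2 (M + a i), hpos] with k h1 h2 hpos
    rw [h1, norm_mul, norm_pow, Real.norm_of_nonneg hpos.le, pow_add, mul_comm] at h2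
    exact le_of_mul_le_mul_right h2 (by positivity))
  have hy0 : Tendsto y 𝒰 (𝓝 0) := by simpa using hx.add (hyx.tendsto_zero ht)
  refine ⟨y, hyx, fun i hi => ?_⟩
  by_cases hz : ∀ᶠ p in 𝓝 (0, 0), f i p = 0
  · exact (hy0.prodMk_nhds ht'0).eventually hz
  · filter_upwards [(hy0.prodMk_nhds ht'0).eventually (hff' ⟨i, hz, hi⟩), hy ⟨i, hz, hi⟩]
      with k h1 h2
    rw [h1, h2, mul_zero]

theorem exists_flat_lift_step (ht : Tendsto t 𝒰 (𝓝[>] 0))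
    (htt : Flat 𝒰 t fun k => t' k - t k) {n : ℕ}
    (IH : ∀ (F : Type) [NormedAddCommGroup F] [NormedSpace ℝ F] [FiniteDimensional ℝ F],
      Module.finrank ℝ F = n → ∀ (α : Type) [Finite α] (f : α → F × ℝ → ℝ),
      (∀ i, AnalyticAt ℝ (f i) (0, 0)) → ∀ x : ι → F, Tendsto x 𝒰 (𝓝 0) →
      ∃ y : ι → F, Flat 𝒰 t (fun k => y k - x k) ∧ ∀ i, (Flat 𝒰 t fun k => f i (x k, t k)) →
        ∀ᶠ k in (𝒰 : Filter ι), f i (y k, t' k) = 0)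
    {E : Type} [NormedAddCommGroup E] [NormedSpace ℝ E] [FiniteDimensional ℝ E]
    (hE : Module.finrank ℝ E = n + 1) {α : Type*} [Finite α] (f : α → E × ℝ → ℝ)
    (hf : ∀ i, AnalyticAt ℝ (f i) (0, 0)) (hne : ∀ i, ¬ ∀ᶠ z in 𝓝 0, f i (z, 0) = 0) (x : ι → E)
    (hx : Tendsto x 𝒰 (𝓝 0)) (hfl : ∀ i, Flat 𝒰 t fun k => f i (x k, t k)) :
    ∃ y : ι → E, Flat 𝒰 t (fun k => y k - x k) ∧
      ∀ i, ∀ᶠ k in (𝒰 : Filter ι), f i (y k, t' k) = 0 := by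
  classical
  have := Fintype.ofFinite α
  rcases isEmpty_or_nonempty α with hα | ⟨⟨i₀⟩⟩
  · exact ⟨x, by simpa using Flat.zero ht, fun i => hα.elim i⟩
  have ht0 : Tendsto t 𝒰 (𝓝 0) := (tendsto_nhdsWithin_iff.1 ht).1
  have ht'0 : Tendsto t' 𝒰 (𝓝 0) := by simpa using ht0.add (htt.tendsto_zero ht)
  obtain ⟨w, hw⟩ := AnalyticAt.exists_direction Finset.univ (f := fun i z => f i (z, 0)) (x₀ := 0)
    (fun i _ => (hf i).fun_comp (f := fun z : E => (z, (0 : ℝ))) (by fun_prop)) fun i _ => hne i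
  have hf0 : ∀ i, f i (0, 0) = 0 := fun i => tendsto_nhds_unique
    ((hf i).continuousAt.tendsto.comp (hx.prodMk_nhds ht0)) ((hfl i).tendsto_zero ht)
  have hw0 : w ≠ 0 := by
    rintro rfl
    refine hw i₀ (Finset.mem_univ _) (Eventually.of_forall fun u => ?_)
    simp [hf0]
  obtain ⟨φ, hφ⟩ := SeparatingDual.exists_eq_one (R := ℝ) hw0
  let F : Submodule ℝ E := LinearMap.ker (φ : E →ₗ[ℝ] ℝ)
  have hF : Module.finrank ℝ F = n := by
    have h1 := LinearMap.finrank_range_add_finrank_ker (φ : E →ₗ[ℝ] ℝ)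
    have h2 : LinearMap.range (φ : E →ₗ[ℝ] ℝ) = ⊤ :=
      LinearMap.range_eq_top.2 fun c => ⟨c • w, by simp [hφ]⟩
    rw [h2, finrank_top, Module.finrank_self, hE] at h1
    change Module.finrank ℝ F = n
    change 1 + Module.finrank ℝ F = n + 1 at h1
    omega
  let x' : ι → F := fun k => ⟨x k - φ (x k) • w, by simp [F, hφ]⟩
  have hx' : Tendsto x' 𝒰 (𝓝 0) := by
    rw [tendsto_subtype_rng]
    have : Tendsto (fun k => x k - φ (x k) • w) 𝒰 (𝓝 (0 - φ 0 • w)) :=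
      hx.sub (((φ.continuous.tendsto 0).comp hx).smul_const w)
    simpa using this
  let s : ι → ℝ := fun k => φ (x k)
  have hs : Tendsto s 𝒰 (𝓝 0) := by
    have := (φ.continuous.tendsto 0).comp hx
    rwa [map_zero] at this
  let Φ : (F × ℝ) × ℝ → E × ℝ := fun q => ((q.1.1 : E) + q.2 • w, q.1.2)
  have hΦ : AnalyticAt ℝ Φ ((0, 0), 0) := by
    let L : (F × ℝ) × ℝ →L[ℝ] E × ℝ :=
      (F.subtypeL ∘L ContinuousLinearMap.fst ℝ F ℝ ∘L ContinuousLinearMap.fst ℝ (F × ℝ) ℝ +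
        (ContinuousLinearMap.snd ℝ (F × ℝ) ℝ).smulRight w).prod
      (ContinuousLinearMap.snd ℝ F ℝ ∘L ContinuousLinearMap.fst ℝ (F × ℝ) ℝ)
    exact L.analyticAt _
  have hΦ0 : Φ ((0, 0), 0) = (0, 0) := by simp [Φ]
  have hH : ∀ i, AnalyticAt ℝ (fun q => f i (Φ q)) ((0, 0), 0) := fun i =>
    AnalyticAt.fun_comp (g := f i) (f := Φ) (by rw [hΦ0]; exact hf i) hΦ
  have hHne : ∀ i, ¬ ∀ᶠ u : ℝ in 𝓝 0, f i (Φ ((0, 0), u)) = 0 := fun i => by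
    simpa [Φ] using hw i (Finset.mem_univ _)
  choose d W u hWm hWd hWa hu hu0 hfW using fun i => (hH i).exists_weierstrass_polynomial (hHne i)
  let P : F × ℝ → ℝ[X] := fun z => ∏ i, W i z
  have hPm : ∀ z, (P z).Monic := fun z => monic_prod_of_monic _ _ fun i _ => hWm i z
  set D := ∑ i, d i with hD
  have hPd : ∀ z, (P z).natDegree = D := fun z => by
    rw [natDegree_prod_of_monic _ _ fun i _ => hWm i z]
    exact Finset.sum_congr rfl fun i _ => hWd i z
  have hPa : ∀ j, AnalyticAt ℝ (fun z => (P z).coeff j) (0, 0) :=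
    analyticAt_coeff_prod _ hWa
  choose Q hQ using exists_eval_coeff_eq_subDiscr D
  obtain ⟨y', hyx', hy'⟩ := IH F hF (Fin (D + 1))
    (fun m z => MvPolynomial.eval (fun j : Fin D => (P z).coeff j) (Q m))
    (fun m => by
      have := AnalyticAt.aeval_mvPolynomial (f := fun z => fun j : Fin D => (P z).coeff j)
        (z := ((0, 0) : F × ℝ)) (fun j => hPa j) (Q m)
      exact this) x' hx'
  have hy'0 : Tendsto y' 𝒰 (𝓝 0) := by simpa using hx'.add (hyx'.tendsto_zero ht)
  let z : ι → F × ℝ := fun k => (x' k, t k)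
  let z' : ι → F × ℝ := fun k => (y' k, t' k)
  have hz : Tendsto z 𝒰 (𝓝 (0, 0)) := hx'.prodMk_nhds ht0
  have hz' : Tendsto z' 𝒰 (𝓝 (0, 0)) := hy'0.prodMk_nhds ht'0
  have hzz : Flat 𝒰 t fun k => z' k - z k := hyx'.prodMk htt
  have hΦx : ∀ k, Φ (z k, s k) = (x k, t k) := fun k => by simp [Φ, z, s, x']
  have hroot : ∀ i, ∃ ζ : ι → ℂ, (∀ k, aeval (ζ k) (W i (z' k)) = 0) ∧
      Flat 𝒰 t fun k => (s k : ℂ) - ζ k := by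
    intro i
    have h1 : Flat 𝒰 t fun k => f i (Φ (z' k, s k)) := by
      have h2 := (Flat.comp_sub (x := fun k => (z k, s k)) (y := fun k => (z' k, s k)) ht (hH i)
        (hz.prodMk_nhds hs) ?_).add ht (hfl i)
      · simpa [hΦx] using h2
      · have := hzz.prodMk (Flat.zero (E := ℝ) ht)
        simpa using this
    have h2 : Flat 𝒰 t fun k => (W i (z' k)).eval (s k) := by
      refine h1.of_norm_le_mul ht (2 / ‖u i ((0, 0), 0)‖) ?_
      have hu' : Tendsto (fun k => ‖u i (z' k, s k)‖) 𝒰 (𝓝 ‖u i ((0, 0), 0)‖) :=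
        ((hu i).continuousAt.tendsto.comp (hz'.prodMk_nhds hs)).norm
      have hpos : 0 < ‖u i ((0, 0), 0)‖ := norm_pos_iff.2 (hu0 i)
      filter_upwards [(hz'.prodMk_nhds hs).eventually (hfW i),
        hu'.eventually_const_le (half_lt_self hpos)] with k h1 h2
      rw [h1, norm_mul]
      rw [div_mul_eq_mul_div, le_div_iff₀ hpos]
      nlinarith [norm_nonneg ((W i (z' k)).eval (s k))]
    choose ξ hξ using fun k => exists_roots_of_monic (hWm i (z' k)) (hWd i (z' k))
    have haeval : ∀ k (c : ℂ), aeval c (W i (z' k)) = ∏ j, (c - ξ k j) := fun k c => by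
      rw [← aeval_map_algebraMap ℂ, hξ, map_prod]
      simp
    have h3 : Flat 𝒰 t fun k => ∏ j, ((s k : ℂ) - ξ k j) := by
      refine h2.of_norm_le (Eventually.of_forall fun k => ?_)
      rw [← haeval, ← Complex.norm_real, ← Complex.coe_algebraMap, ← aeval_algebraMap_apply_eq_algebraMap_eval]
    obtain ⟨j, -, hj⟩ := Flat.exists_of_prod (f := fun j k => (s k : ℂ) - ξ k j) ht Finset.univ h3
    exact ⟨fun k => ξ k j, fun k => by
      rw [haeval]
      exact Finset.prod_eq_zero (Finset.mem_univ j) (sub_self _), hj⟩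
  choose ζ hζ hsζ using hroot
  have hProot : ∀ k i (c : ℂ), aeval c (W i (z' k)) = 0 → aeval c (P (z' k)) = 0 := fun k i c h => by
    rw [map_prod]
    exact Finset.prod_eq_zero (Finset.mem_univ i) h
  obtain ⟨K, hK⟩ : ∃ K : ℝ, ∀ᶠ q in 𝓝 ((0, 0) : F × ℝ), ∀ j, |(P q).coeff j| ≤ K := by
    have hc : ContinuousAt (fun q => ∑ j ∈ Finset.range (D + 1), |(P q).coeff j|) (0, 0) :=
      tendsto_finsetSum _ fun j _ => (hPa j).continuousAt.abs
    refine ⟨∑ j ∈ Finset.range (D + 1), |(P (0, 0)).coeff j| + 1,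
      (hc.eventually_lt_const (lt_add_one _)).mono fun q hq j => ?_⟩
    rcases Nat.lt_or_ge j (D + 1) with hj | hj
    · exact (Finset.single_le_sum (f := fun j => |(P q).coeff j|) (fun _ _ => abs_nonneg _)
        (Finset.mem_range.2 hj)).trans hq.le
    · rw [coeff_eq_zero_of_natDegree_lt (by rw [hPd]; omega), abs_zero]
      exact (Finset.sum_nonneg fun _ _ => abs_nonneg _).trans hq.le
  have heq : ∀ ξ ξ' : ι → ℂ, (∀ k, aeval (ξ k) (P (z' k)) = 0) → (∀ k, aeval (ξ' k) (P (z' k)) = 0) →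
      (Flat 𝒰 t fun k => (s k : ℂ) - ξ k) → (Flat 𝒰 t fun k => (s k : ℂ) - ξ' k) →
      ∀ᶠ k in (𝒰 : Filter ι), ξ k = ξ' k := fun ξ ξ' h1 h2 h3 h4 =>
    Flat.eventually_eq_roots (p := fun k => P (z k)) (p' := fun k => P (z' k)) ht (fun _ => hPm _)
      (fun _ => hPd _) (fun _ => hPm _) (fun _ => hPd _)
      (((hz.eventually hK).and (hz'.eventually hK)).mono fun k hk j => ⟨hk.1 j, hk.2 j⟩)
      (fun j => Flat.comp_sub ht (hPa j) hz hzz) Q hQ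
      (fun m hm h => hy' ⟨m, by omega⟩ h) (Eventually.of_forall h1) (Eventually.of_forall h2)
      (h3.sub_comm.sub_trans ht h4)
  have hreal : ∀ᶠ k in (𝒰 : Filter ι), (starRingEnd ℂ) (ζ i₀ k) = ζ i₀ k := by
    refine heq _ _ (fun k => ?_) (fun k => hProot k i₀ _ (hζ i₀ k)) ?_ (hsζ i₀)
    · rw [aeval_conj, hProot k i₀ _ (hζ i₀ k), map_zero]
    · refine (hsζ i₀).of_norm_le (Eventually.of_forall fun k => ?_)
      rw [← Complex.norm_conj, map_sub, Complex.conj_conj, Complex.conj_ofReal]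
  have hre : Flat 𝒰 t fun k => (ζ i₀ k).re - s k := by
    refine (hsζ i₀).of_norm_le (Eventually.of_forall fun k => ?_)
    rw [norm_sub_rev]
    simpa using Complex.abs_re_le_norm ((s k : ℂ) - ζ i₀ k)
  have hre0 : Tendsto (fun k => (ζ i₀ k).re) 𝒰 (𝓝 0) := by
    simpa using hs.add (hre.tendsto_zero ht)
  refine ⟨fun k => y' k + (ζ i₀ k).re • w, ?_, fun i => ?_⟩
  · have h1 : Flat 𝒰 t fun k => ((y' k - x' k : F) : E) :=
      hyx'.of_norm_le (Eventually.of_forall fun k => le_rfl)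
    have h2 : Flat 𝒰 t fun k => ((ζ i₀ k).re - s k) • w :=
      hre.of_norm_le_mul ht ‖w‖ (Eventually.of_forall fun k => by rw [norm_smul, mul_comm])
    refine (h1.add ht h2).congr' (Eventually.of_forall fun k => ?_)
    simp only [Submodule.coe_sub, x', s, sub_smul]
    abel
  · filter_upwards [(hz'.prodMk_nhds hre0).eventually (hfW i), hreal,
      heq _ _ (fun k => hProot k i₀ _ (hζ i₀ k)) (fun k => hProot k i _ (hζ i k)) (hsζ i₀) (hsζ i)]
      with k h1 h2 h3
    change f i (Φ (z' k, (ζ i₀ k).re)) = 0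
    rw [h1]
    have h4 : (((W i (z' k)).eval (ζ i₀ k).re : ℝ) : ℂ) = 0 := by
      rw [← Complex.coe_algebraMap, ← aeval_algebraMap_apply_eq_algebraMap_eval,
        Complex.coe_algebraMap, Complex.conj_eq_iff_re.1 h2, h3, hζ]
    rw [Complex.ofReal_eq_zero.1 h4, mul_zero]

/-- If analytic functions are flat along a sequence then their common zero set contains a flatly
close sequence. -/
theorem exists_flat_lift (ht : Tendsto t 𝒰 (𝓝[>] 0)) (htt : Flat 𝒰 t fun k => t' k - t k) (n : ℕ)
    (E : Type) [NormedAddCommGroup E] [NormedSpace ℝ E] [FiniteDimensional ℝ E]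
    (hE : Module.finrank ℝ E = n) (α : Type) [Finite α] (f : α → E × ℝ → ℝ)
    (hf : ∀ i, AnalyticAt ℝ (f i) (0, 0)) (x : ι → E) (hx : Tendsto x 𝒰 (𝓝 0)) :
    ∃ y : ι → E, Flat 𝒰 t (fun k => y k - x k) ∧ ∀ i, (Flat 𝒰 t fun k => f i (x k, t k)) →
      ∀ᶠ k in (𝒰 : Filter ι), f i (y k, t' k) = 0 := by
  have ht0 : Tendsto t 𝒰 (𝓝 0) := (tendsto_nhdsWithin_iff.1 ht).1
  induction n generalizing E α with
  | zero =>
    refine exists_flat_lift_of_forall_ne_zero ht htt (fun s f hf hne x hx hfl => ?_) f hf x hx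
    refine ⟨x, by simpa using Flat.zero ht, fun i => (hne i ?_).elim⟩
    have := Module.finrank_zero_iff.1 hE
    have h0 : f i (0, 0) = 0 := tendsto_nhds_unique
      ((hf i).continuousAt.tendsto.comp (hx.prodMk_nhds ht0)) ((hfl i).tendsto_zero ht)
    exact Eventually.of_forall fun z => by rw [Subsingleton.elim z 0, h0]
  | succ n ih =>
    exact exists_flat_lift_of_forall_ne_zero ht htt
      (fun s f hf hne x hx hfl => exists_flat_lift_step ht htt ih hE f hf hne x hx hfl) f hf x hx

end Lift

section Sequences

variable {V : Type*} [NormedAddCommGroup V]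

theorem tendsto_norm_hyperfilter {x : ℕ → V} (hx0 : ∀ k, x k ≠ 0)
    (hx : ∀ k, ‖x k‖ < 1 / ((k : ℝ) + 1)) :
    Tendsto (fun k => ‖x k‖) (hyperfilter ℕ) (𝓝[>] 0) := by
  refine tendsto_nhdsWithin_iff.2 ⟨?_, Eventually.of_forall fun k => norm_pos_iff.2 (hx0 k)⟩
  refine Tendsto.mono_left ?_ (Nat.cofinite_eq_atTop ▸ hyperfilter_le_cofinite)
  exact squeeze_zero (fun _ => norm_nonneg _) (fun k => (hx k).le)
    tendsto_one_div_add_atTop_nhds_zero_nat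

theorem eventually_hyperfilter_ge (M : ℕ) : ∀ᶠ k in (hyperfilter ℕ : Filter ℕ), M ≤ k :=
  (Nat.cofinite_eq_atTop ▸ hyperfilter_le_cofinite : (hyperfilter ℕ : Filter ℕ) ≤ atTop)
    (eventually_ge_atTop M)

theorem exists_seq_of_frequently {p : ℕ → V → Prop} (h : ∀ k, ∃ᶠ x in 𝓝[≠] 0, p k x) :
    ∃ x : ℕ → V, (∀ k, x k ≠ 0) ∧ (∀ k, ‖x k‖ < 1 / ((k : ℝ) + 1)) ∧ ∀ k, p k (x k) := by
  have : ∀ k : ℕ, ∃ x : V, x ≠ 0 ∧ ‖x‖ < 1 / ((k : ℝ) + 1) ∧ p k x := fun k => by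
    have hk : (0 : ℝ) < 1 / ((k : ℝ) + 1) := by positivity
    have h1 : ∀ᶠ x : V in 𝓝[≠] 0, x ≠ 0 ∧ ‖x‖ < 1 / ((k : ℝ) + 1) := by
      filter_upwards [self_mem_nhdsWithin, mem_nhdsWithin_of_mem_nhds (ball_mem_nhds 0 hk)]
        with x hx hx'
      exact ⟨hx, by simpa using hx'⟩
    obtain ⟨x, hp, h1, h2⟩ := ((h k).and_eventually h1).exists
    exact ⟨x, h1, h2, hp⟩
  choose x hx using this
  exact ⟨x, fun k => (hx k).1, fun k => (hx k).2.1, fun k => (hx k).2.2⟩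

end Sequences

section Sphere

variable {V : Type} [NormedAddCommGroup V] [InnerProductSpace ℝ V] [FiniteDimensional ℝ V]

theorem exists_flat_nonneg {ι : Type*} {𝒰 : Ultrafilter ι} {t t' : ι → ℝ}
    (ht : Tendsto t 𝒰 (𝓝[>] 0)) (htt : Flat 𝒰 t fun k => t' k - t k)
    (ht' : ∀ᶠ k in (𝒰 : Filter ι), 0 ≤ t' k) {α : Type} [Finite α] {g : α → V → ℝ}
    (hg : ∀ i, AnalyticAt ℝ (g i) 0) {x : ι → V} (hx : ∀ k, ‖x k‖ = t k)
    (hgx : ∀ i, ∀ M : ℕ, ∀ᶠ k in (𝒰 : Filter ι), -t k ^ M ≤ g i (x k)) :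
    ∃ y : ι → V, Flat 𝒰 t (fun k => y k - x k) ∧
      ∀ᶠ k in (𝒰 : Filter ι), ‖y k‖ = t' k ∧ ∀ i, 0 ≤ g i (y k) := by
  have ht0 : Tendsto t 𝒰 (𝓝 0) := (tendsto_nhdsWithin_iff.1 ht).1
  have hx0 : Tendsto x 𝒰 (𝓝 0) := by
    rw [tendsto_zero_iff_norm_tendsto_zero]
    simpa only [hx] using ht0
  let F : Option α → V × ℝ → ℝ := fun i p => i.elim (inner ℝ p.1 p.1 - p.2 ^ 2) fun i => g i p.1
  have hF : ∀ i, AnalyticAt ℝ (F i) (0, 0) := by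
    rintro (_ | i)
    · have h1 : ContDiff ℝ ⊤ fun p : V × ℝ => inner ℝ p.1 p.1 - p.2 ^ 2 :=
        (contDiff_fst.inner ℝ contDiff_fst).sub (contDiff_snd.pow 2)
      exact h1.contDiffAt.analyticAt
    · exact AnalyticAt.fun_comp (g := g i) (f := fun p : V × ℝ => p.1) (hg i) analyticAt_fst
  obtain ⟨y, hyx, hy⟩ := exists_flat_lift ht htt _ V rfl _ F hF x hx0
  refine ⟨y, hyx, ?_⟩
  have h1 : ∀ᶠ k in (𝒰 : Filter ι), F none (y k, t' k) = 0 := by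
    refine hy none ((Flat.zero (E := ℝ) ht).congr' (Eventually.of_forall fun k => ?_))
    simp [F, hx]
  refine Eventually.and ?_ (eventually_all.2 fun i => ?_)
  · filter_upwards [h1, ht'] with k h1 h2
    simp only [F, Option.elim_none, real_inner_self_eq_norm_sq, sub_eq_zero] at h1
    exact (pow_left_inj₀ (norm_nonneg _) h2 two_ne_zero).1 h1
  · by_cases h : Flat 𝒰 t fun k => g i (x k)
    · exact (hy (some i) h).mono fun k hk => hk.ge
    · simp only [Flat, not_forall] at h
      obtain ⟨M, hM⟩ := h
      filter_upwards [Ultrafilter.eventually_not.2 hM, hgx i M, Flat.comp_sub ht (hg i) hx0 hyx M]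
        with k h1 h2 h3
      rw [not_le, Real.norm_eq_abs, lt_abs] at h1
      have := (abs_le.1 h3).1
      rcases h1 with h1 | h1 <;> linarith

/-- A Łojasiewicz type inequality on spheres: points at which analytic inequalities are almost
satisfied are close to points of the same norm at which they are satisfied. -/
theorem exists_lojasiewicz_sphere {α : Type} [Finite α] {g : α → V → ℝ}
    (hg : ∀ i, AnalyticAt ℝ (g i) 0) (σ : ℕ) : ∃ e : ℕ, ∀ᶠ x in 𝓝[≠] (0 : V),
      (∀ i, -‖x‖ ^ e ≤ g i x) → ∃ y, ‖y‖ = ‖x‖ ∧ (∀ i, 0 ≤ g i y) ∧ ‖y - x‖ ≤ ‖x‖ ^ σ := by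
  by_contra! hcon
  obtain ⟨x, hx0, hx1, hx⟩ := exists_seq_of_frequently hcon
  have ht := tendsto_norm_hyperfilter hx0 hx1
  have h1 : ∀ k, ‖x k‖ ≤ 1 := fun k => (hx1 k).le.trans (by
    rw [div_le_one (by positivity)]
    linarith [(Nat.cast_nonneg k : (0 : ℝ) ≤ k)])
  obtain ⟨y, hyx, hy⟩ := exists_flat_nonneg ht (t' := fun k => ‖x k‖)
    (by simpa using Flat.zero (E := ℝ) ht) (Eventually.of_forall fun _ => norm_nonneg _) hg
    (x := x) (fun _ => rfl) (fun i M => by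
      filter_upwards [eventually_hyperfilter_ge M] with k hk
      have h2 := (hx k).1 i
      have h3 := pow_le_pow_of_le_one (norm_nonneg (x k)) (h1 k) hk
      linarith)
  obtain ⟨k, ⟨hk1, hk2⟩, hk3⟩ := (hy.and (hyx σ)).exists
  exact absurd hk3 (not_le.2 ((hx k).2 (y k) hk1 hk2))

theorem eventually_exists_norm_eq {α : Type} [Finite α] {g : α → V → ℝ}
    (hg : ∀ i, AnalyticAt ℝ (g i) 0) (hacc : ∃ᶠ x in 𝓝[≠] (0 : V), ∀ i, 0 ≤ g i x) :
    ∀ᶠ r in 𝓝[>] (0 : ℝ), ∃ x : V, ‖x‖ = r ∧ ∀ i, 0 ≤ g i x := by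
  by_contra hcon
  rw [not_eventually] at hcon
  have hcont : ∀ᶠ x in 𝓝 (0 : V), ∀ i, ContinuousAt (g i) x := eventually_all.2 fun i =>
    (hg i).eventually_analyticAt.mono fun _ h => h.continuousAt
  obtain ⟨δ, hδ, hcont⟩ := Metric.eventually_nhds_iff_ball.1 hcont
  have key : ∀ k : ℕ, ∃ᶠ x in 𝓝[≠] (0 : V), (∀ i, 0 ≤ g i x) ∧
      ∃ t' : ℝ, ‖x‖ < t' ∧ t' - ‖x‖ ≤ ‖x‖ ^ k ∧ ∀ y, (∀ i, 0 ≤ g i y) → ‖y‖ ≠ t' := by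
    intro k
    rw [Metric.nhdsWithin_basis_ball.frequently_iff]
    intro ε hε
    obtain ⟨r, hr, hr0, hrδ, hrε⟩ := (hcon.and_eventually (eventually_mem_nhdsWithin.and
      ((eventually_nhdsWithin_of_eventually_nhds (gt_mem_nhds hδ)).and
        (eventually_nhdsWithin_of_eventually_nhds (gt_mem_nhds hε))))).exists
    replace hr0 : 0 < r := hr0
    push Not at hr
    obtain ⟨a, ha, hab, ha0⟩ := (hacc.and_eventually ((eventually_nhdsWithin_of_eventually_nhds
      (ball_mem_nhds 0 hr0)).and eventually_mem_nhdsWithin)).exists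
    have hsub : closedBall (0 : V) r ⊆ ball 0 δ := closedBall_subset_ball hrδ
    have hcl : IsCompact (closedBall (0 : V) r ∩ {x | ∀ i, 0 ≤ g i x}) := by
      refine (isCompact_closedBall 0 r).of_isClosed_subset ?_ inter_subset_left
      have : closedBall (0 : V) r ∩ {x | ∀ i, 0 ≤ g i x} =
          closedBall 0 r ∩ ⋂ i, closedBall 0 r ∩ g i ⁻¹' Ici 0 := by
        ext x
        simp only [mem_inter_iff, mem_ofPred_eq, mem_iInter, mem_preimage, mem_Ici]
        exact ⟨fun h => ⟨h.1, fun i => ⟨h.1, h.2 i⟩⟩, fun h => ⟨h.1, fun i => (h.2 i).2⟩⟩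
      rw [this]
      refine isClosed_closedBall.inter (isClosed_iInter fun i => ?_)
      exact ContinuousOn.preimage_isClosed_of_isClosed
        (fun x hx => (hcont x (hsub hx) i).continuousWithinAt) isClosed_closedBall isClosed_Ici
    obtain ⟨x, ⟨hxr, hxg⟩, hmax⟩ := hcl.exists_isMaxOn ⟨a, ball_subset_closedBall hab, ha⟩
      continuous_norm.continuousOn
    have hax : ‖a‖ ≤ ‖x‖ := hmax ⟨ball_subset_closedBall hab, ha⟩
    have hx0 : 0 < ‖x‖ := (norm_pos_iff.2 ha0).trans_le hax
    rw [mem_closedBall_zero_iff] at hxr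
    have hxr' : ‖x‖ < r := hxr.lt_of_ne fun h => by
      obtain ⟨i, hi⟩ := hr x h
      exact absurd (hxg i) (not_le.2 hi)
    obtain ⟨c, hc1, hc2⟩ := exists_between
      (lt_min hxr' (lt_add_of_pos_right ‖x‖ (pow_pos hx0 k)))
    refine ⟨x, ⟨by simpa using hxr'.trans hrε, norm_pos_iff.1 hx0⟩, hxg, c, hc1, ?_,
      fun y hy hyc => ?_⟩
    · linarith [hc2.trans_le (min_le_right _ _)]
    · have : ‖y‖ ≤ ‖x‖ := hmax ⟨by
        rw [mem_closedBall_zero_iff, hyc]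
        exact (hc2.trans_le (min_le_left _ _)).le, hy⟩
      linarith
  obtain ⟨x, hx0, hx1, hx⟩ := exists_seq_of_frequently key
  have ht := tendsto_norm_hyperfilter hx0 hx1
  have h1 : ∀ k, ‖x k‖ ≤ 1 := fun k => (hx1 k).le.trans (by
    rw [div_le_one (by positivity)]
    linarith [(Nat.cast_nonneg k : (0 : ℝ) ≤ k)])
  choose hxg t' ht' htt hno using hx
  obtain ⟨y, -, hy⟩ := exists_flat_nonneg ht (t' := t') (fun M => by
      filter_upwards [eventually_hyperfilter_ge M] with k hk
      rw [Real.norm_of_nonneg (by linarith [ht' k])]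
      exact (htt k).trans (pow_le_pow_of_le_one (norm_nonneg (x k)) (h1 k) hk))
    (Eventually.of_forall fun k => (norm_nonneg _).trans (ht' k).le) hg
    (x := x) (fun _ => rfl) (fun i M => Eventually.of_forall fun k =>
      (neg_nonpos.2 (pow_nonneg (norm_nonneg _) M)).trans (hxg k i))
  obtain ⟨k, hk1, hk2⟩ := hy.exists
  exact hno k (y k) hk2 hk1

end Sphere

section Curve

variable {V : Type*} [NormedAddCommGroup V] [InnerProductSpace ℝ V]

theorem Polynomial.exists_flat_of_flat_eval {ι : Type*} {𝒰 : Ultrafilter ι} {t : ι → ℝ}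
    (ht : Tendsto t 𝒰 (𝓝[>] 0)) {d : ℕ} {p : ι → Polynomial ℝ} (hp : ∀ k, (p k).Monic)
    (hd : ∀ k, (p k).natDegree = d) (v : Fin (d + 1) → ι → ℝ)
    (hv : ∀ j, Flat 𝒰 t fun k => (p k).eval (v j k)) :
    ∃ i j, i ≠ j ∧ Flat 𝒰 t fun k => v i k - v j k := by
  choose ξ hξ using fun k => exists_roots_of_monic (hp k) (hd k)
  have h1 : ∀ j, ∃ i, Flat 𝒰 t fun k => (v j k : ℂ) - ξ k i := fun j => by
    have h3 : Flat 𝒰 t fun k => ∏ i, ((v j k : ℂ) - ξ k i) := by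
      refine (hv j).of_norm_le (Eventually.of_forall fun k => ?_)
      have haeval : aeval (v j k : ℂ) (p k) = ∏ i, ((v j k : ℂ) - ξ k i) := by
        rw [← aeval_map_algebraMap ℂ, hξ, map_prod]
        simp
      rw [← haeval, ← Complex.norm_real, ← Complex.coe_algebraMap,
        ← aeval_algebraMap_apply_eq_algebraMap_eval]
    obtain ⟨i, -, hi⟩ := Flat.exists_of_prod (f := fun i k => (v j k : ℂ) - ξ k i) ht Finset.univ h3
    exact ⟨i, hi⟩
  choose φ hφ using h1
  obtain ⟨i, j, hij, hφij⟩ := Fintype.exists_ne_map_eq_of_card_lt φ (by simp)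
  refine ⟨i, j, hij, ?_⟩
  have h2 := hφ j
  rw [← hφij] at h2
  refine ((hφ i).sub_trans ht h2.sub_comm).of_norm_le (Eventually.of_forall fun k => ?_)
  rw [← Complex.ofReal_sub, Complex.norm_real]

theorem norm_inv_norm_smul_sub_le {θ η : V} (hθ : ‖θ‖ = 1) (hη : η ≠ 0) :
    ‖‖η‖⁻¹ • η - θ‖ ≤ 2 * ‖η - θ‖ := by
  have h0 : 0 < ‖η‖ := norm_pos_iff.2 hη
  have h1 : ‖‖η‖⁻¹ • η - η‖ = |1 - ‖η‖| := by
    have : ‖η‖⁻¹ • η - η = (‖η‖⁻¹ * (1 - ‖η‖)) • η := by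
      rw [mul_sub, sub_smul, mul_one, inv_mul_cancel₀ h0.ne', one_smul]
    rw [this, norm_smul, norm_mul, norm_inv, norm_norm, Real.norm_eq_abs]
    field_simp
  have h2 : |1 - ‖η‖| ≤ ‖η - θ‖ := by
    rw [← hθ, norm_sub_rev]
    exact abs_norm_sub_norm_le _ _
  calc ‖‖η‖⁻¹ • η - θ‖ ≤ ‖‖η‖⁻¹ • η - η‖ + ‖η - θ‖ := norm_sub_le_norm_sub_add_norm_sub _ _ _
    _ ≤ _ := by rw [h1]; linarith

/-- From every point near the origin there is a short spherical curve to a point at which a given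
nonzero analytic function is not too small. -/
theorem AnalyticAt.exists_spherical_curve [FiniteDimensional ℝ V] {f : V → ℝ}
    (hf : AnalyticAt ℝ f 0) (hne : ¬ ∀ᶠ x in 𝓝 0, f x = 0) (σ : ℕ) :
    ∃ M : ℕ, ∀ᶠ x in 𝓝[≠] (0 : V), ∃ γ : ℝ → V, ContinuousOn γ (Icc 0 1) ∧ γ 0 = x ∧
      (∀ u ∈ Icc (0 : ℝ) 1, ‖γ u‖ = ‖x‖ ∧ ‖γ u - x‖ ≤ ‖x‖ ^ σ) ∧ ‖x‖ ^ M ≤ |f (γ 1)| := by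
  by_contra hcon
  simp only [not_exists, not_eventually] at hcon
  obtain ⟨x, hx0, hx1, hx⟩ := exists_seq_of_frequently hcon
  have ht := tendsto_norm_hyperfilter hx0 hx1
  set 𝒰 : Ultrafilter ℕ := hyperfilter ℕ
  set r : ℕ → ℝ := fun k => ‖x k‖ with hr
  have hr0 : Tendsto r 𝒰 (𝓝 0) := (tendsto_nhdsWithin_iff.1 ht).1
  have hrpos : ∀ k, 0 < r k := fun k => norm_pos_iff.2 (hx0 k)
  let θ : ℕ → V := fun k => (r k)⁻¹ • x k
  have hθ1 : ∀ k, ‖θ k‖ = 1 := fun k => by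
    rw [norm_smul, norm_inv, Real.norm_of_nonneg (hrpos k).le]
    exact inv_mul_cancel₀ (hrpos k).ne'
  have hθx : ∀ k, r k • θ k = x k := fun k => smul_inv_smul₀ (hrpos k).ne' _
  obtain ⟨θ₀, hθ₀, hθ⟩ := (isCompact_sphere (0 : V) 1).ultrafilter_le_nhds (𝒰.map θ)
    (le_principal_iff.2 (Ultrafilter.mem_map.2 (Eventually.of_forall fun k => by simp [hθ1])))
  replace hθ : Tendsto θ 𝒰 (𝓝 θ₀) := hθ
  rw [mem_sphere_zero_iff_norm] at hθ₀
  have hθ₀0 : θ₀ ≠ 0 := norm_pos_iff.1 (by rw [hθ₀]; exact one_pos)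
  -- the blow-up of `f`
  have hF : AnalyticAt ℝ (fun p : V × ℝ => f (p.2 • p.1)) (θ₀, 0) :=
    AnalyticAt.fun_comp (g := f) (f := fun p : V × ℝ => p.2 • p.1) (by simpa using hf)
      (analyticAt_snd.smul analyticAt_fst)
  have hFne : ¬ ∀ᶠ p : V × ℝ in 𝓝 (θ₀, 0), f (p.2 • p.1) = 0 := by
    intro h
    obtain ⟨ε, hε, hball⟩ := Metric.eventually_nhds_iff_ball.1 hf.eventually_analyticAt
    rw [nhds_prod_eq, Filter.eventually_swap_iff] at h
    have h2 := h.curry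
    have h3 : ∀ᶠ τ : ℝ in 𝓝[>] 0, 0 < τ ∧ τ < ε ∧ ∀ᶠ ξ in 𝓝 θ₀, f (τ • ξ) = 0 :=
      eventually_mem_nhdsWithin.and ((eventually_nhdsWithin_of_eventually_nhds (gt_mem_nhds hε)).and
        (eventually_nhdsWithin_of_eventually_nhds h2))
    obtain ⟨τ, hτ, hτε, h4⟩ := h3.exists
    refine AnalyticOnNhd.not_eventually_eq_zero_of_mem_ball (x₀ := 0) (ε := ε) (fun x hx => hball x hx)
      hne (y := τ • θ₀) ?_ ?_
    · rw [mem_ball_zero_iff, norm_smul, hθ₀, mul_one, Real.norm_of_nonneg hτ.le]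
      exact hτε
    · have h5 : Tendsto (fun y : V => τ⁻¹ • y) (𝓝 (τ • θ₀)) (𝓝 θ₀) := by
        have := (continuous_const_smul τ⁻¹).tendsto (τ • θ₀)
        rwa [inv_smul_smul₀ hτ.ne'] at this
      filter_upwards [h5.eventually h4] with y hy
      rwa [smul_inv_smul₀ hτ.ne'] at hy
  obtain ⟨a, F, hFa, hF0, hfF⟩ := hF.exists_eq_pow_mul hFne
  obtain ⟨w, hw⟩ := AnalyticAt.exists_direction (Finset.univ : Finset Unit)
    (f := fun _ ξ => F (ξ, 0)) (x₀ := θ₀)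
    (fun _ _ => hFa.fun_comp (f := fun z : V => (z, (0 : ℝ))) (by fun_prop)) fun _ _ => hF0
  replace hw := hw () (Finset.mem_univ _)
  let Φ : (V × ℝ) × ℝ → V × ℝ := fun q => (q.1.1 + q.2 • w, q.1.2 * ‖q.1.1 + q.2 • w‖⁻¹)
  have hΦ : AnalyticAt ℝ Φ ((θ₀, 0), 0) := by
    have h0 : AnalyticAt ℝ (fun q : (V × ℝ) × ℝ => q.1.1 + q.2 • w) ((θ₀, 0), 0) :=
      (ContinuousLinearMap.fst ℝ V ℝ ∘L ContinuousLinearMap.fst ℝ (V × ℝ) ℝ +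
        (ContinuousLinearMap.snd ℝ (V × ℝ) ℝ).smulRight w).analyticAt _
    have h1 : AnalyticAt ℝ (fun q : (V × ℝ) × ℝ => q.1.2) ((θ₀, 0), 0) :=
      (ContinuousLinearMap.snd ℝ V ℝ ∘L ContinuousLinearMap.fst ℝ (V × ℝ) ℝ).analyticAt _
    have h2 : AnalyticAt ℝ (fun q : (V × ℝ) × ℝ => ‖q.1.1 + q.2 • w‖) ((θ₀, 0), 0) := by
      refine AnalyticAt.fun_comp (g := fun v : V => ‖v‖) (f := fun q : (V × ℝ) × ℝ => q.1.1 + q.2 • w)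
        ?_ h0
      exact (contDiffAt_norm (n := ⊤) ℝ (by simpa using hθ₀0)).analyticAt
    exact h0.prod (h1.mul (h2.inv (by simp [hθ₀])))
  have hΦ0 : Φ ((θ₀, 0), 0) = (θ₀, 0) := by simp [Φ]
  have hH : AnalyticAt ℝ (fun q => F (Φ q)) ((θ₀, 0), 0) :=
    AnalyticAt.fun_comp (g := F) (f := Φ) (by rwa [hΦ0]) hΦ
  obtain ⟨d, W, u, hWm, hWd, -, hu, hu0, hFW⟩ :=
    hH.exists_weierstrass_polynomial (by simpa [Φ] using hw)
  let v : Fin (d + 1) → ℕ → ℝ := fun j k => (j : ℕ) * r k ^ (σ + 1)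
  have hv : ∀ j, Tendsto (v j) 𝒰 (𝓝 0) := fun j => by
    simpa using (hr0.pow (σ + 1)).const_mul ((j : ℕ) : ℝ)
  have hz : Tendsto (fun k => (θ k, r k)) 𝒰 (𝓝 (θ₀, 0)) := hθ.prodMk_nhds hr0
  have hflat : ∀ j, Flat 𝒰 r fun k => (W (θ k, r k)).eval (v j k) := by
    intro j
    let η : ℕ → V := fun k => θ k + v j k • w
    have hη : Tendsto η 𝒰 (𝓝 θ₀) := by
      simpa using hθ.add ((hv j).smul_const w)
    have hfη : Flat 𝒰 r fun k => f ((r k * ‖η k‖⁻¹) • η k) := by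
      intro M
      have hsmall : Tendsto (fun k => 2 * (d * r k ^ (σ + 1) * ‖w‖)) 𝒰 (𝓝 0) := by
        have := (((hr0.pow (σ + 1)).const_mul (d : ℝ)).mul_const ‖w‖).const_mul 2
        simpa using this
      have hsmall' : Tendsto (fun k => 2 * d * r k ^ 2 * ‖w‖) 𝒰 (𝓝 0) := by
        have := ((hr0.pow 2).const_mul (2 * d : ℝ)).mul_const ‖w‖
        simpa using this
      filter_upwards [eventually_hyperfilter_ge M, hsmall.eventually_lt_const one_pos,
        hsmall'.eventually_lt_const one_pos, hr0.eventually_lt_const one_pos] with k hk h1 h2 h3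
      have hpos := hrpos k
      let e : ℝ → V := fun u => θ k + (u * v j k) • w
      have he : ∀ c ∈ Icc (0 : ℝ) 1, ‖e c - θ k‖ ≤ d * r k ^ (σ + 1) * ‖w‖ := by
        intro c hc
        have hj : ((j : ℕ) : ℝ) ≤ d := by exact_mod_cast Nat.lt_succ_iff.1 j.2
        have hv0 : 0 ≤ v j k := by positivity
        simp only [e, add_sub_cancel_left, norm_smul, norm_mul, Real.norm_of_nonneg hc.1,
          Real.norm_of_nonneg hv0]
        refine mul_le_mul_of_nonneg_right ?_ (norm_nonneg w)
        calc c * v j k ≤ 1 * v j k := by gcongr; exact hc.2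
          _ = (j : ℕ) * r k ^ (σ + 1) := one_mul _
          _ ≤ _ := by gcongr
      have he0 : ∀ c ∈ Icc (0 : ℝ) 1, e c ≠ 0 := by
        intro c hc h0
        have := he c hc
        rw [h0, zero_sub, norm_neg, hθ1] at this
        linarith
      have hec : Continuous e := by fun_prop
      have hno : ¬ r k ^ k ≤ |f ((r k * ‖η k‖⁻¹) • η k)| := by
        intro hge
        refine hx k (fun c => r k • ‖e c‖⁻¹ • e c) ⟨?_, ?_, fun c hc => ⟨?_, ?_⟩, ?_⟩
        · refine continuousOn_const.smul (ContinuousOn.smul (ContinuousOn.inv₀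
            hec.norm.continuousOn fun c hc => (norm_pos_iff.2 (he0 c hc)).ne') hec.continuousOn)
        · simp [e, hθ1, hθx]
        · rw [norm_smul, norm_smul, norm_inv, norm_norm (e c),
            inv_mul_cancel₀ (norm_pos_iff.2 (he0 c hc)).ne', mul_one]
          exact Real.norm_of_nonneg hpos.le
        · rw [← hθx k, ← smul_sub, norm_smul, norm_smul, hθ1, mul_one,
            Real.norm_of_nonneg hpos.le]
          have h4 := (norm_inv_norm_smul_sub_le (hθ1 k) (he0 c hc)).trans
            (mul_le_mul_of_nonneg_left (he c hc) zero_le_two)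
          calc r k * ‖‖e c‖⁻¹ • e c - θ k‖ ≤ r k * (2 * (d * r k ^ (σ + 1) * ‖w‖)) := by gcongr
            _ = r k ^ σ * (2 * d * r k ^ 2 * ‖w‖) := by ring
            _ ≤ r k ^ σ * 1 := by gcongr
            _ = _ := mul_one _
        · simpa [e, η, smul_smul, mul_assoc] using hge
      rw [not_le] at hno
      exact hno.le.trans (pow_le_pow_of_le_one hpos.le h3.le hk)
    have hη1 : ∀ᶠ k in (𝒰 : Filter ℕ), ‖η k‖ < 2 ∧ 1 / 2 < ‖η k‖ := by
      have := hη.norm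
      rw [hθ₀] at this
      exact (this.eventually_lt_const (by norm_num)).and (this.eventually_const_lt (by norm_num))
    have hFη : Flat 𝒰 r fun k => F (Φ ((θ k, r k), v j k)) := by
      have h1 : Flat 𝒰 r fun k => f ((r k * ‖η k‖⁻¹) • η k) / r k ^ a := fun M => by
        filter_upwards [hfη (M + a)] with k hk
        rw [norm_div, norm_pow, Real.norm_of_nonneg (hrpos k).le,
          div_le_iff₀ (pow_pos (hrpos k) a), ← pow_add]
        exact hk
      refine h1.of_norm_le_mul ht (2 ^ a) ?_
      have h2 : Tendsto (fun k => Φ ((θ k, r k), v j k)) 𝒰 (𝓝 (θ₀, 0)) := by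
        rw [← hΦ0]
        exact hΦ.continuousAt.tendsto.comp (hz.prodMk_nhds (hv j))
      filter_upwards [h2.eventually hfF, hη1] with k h3 h4
      have hη0 : 0 < ‖η k‖ := by linarith [h4.2]
      have hpos := hrpos k
      have h5 : f ((r k * ‖η k‖⁻¹) • η k) = (r k * ‖η k‖⁻¹) ^ a * F (Φ ((θ k, r k), v j k)) := h3
      have h6 : F (Φ ((θ k, r k), v j k)) =
          ‖η k‖ ^ a * (f ((r k * ‖η k‖⁻¹) • η k) / r k ^ a) := by
        rw [h5, mul_pow, inv_pow]
        field_simp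
      rw [h6, norm_mul, norm_pow, norm_norm]
      gcongr
      exact h4.1.le
    have hu' : Tendsto (fun k => ‖u ((θ k, r k), v j k)‖) 𝒰 (𝓝 ‖u ((θ₀, 0), 0)‖) :=
      (hu.continuousAt.tendsto.comp (hz.prodMk_nhds (hv j))).norm
    have hpos : 0 < ‖u ((θ₀, 0), 0)‖ := norm_pos_iff.2 hu0
    refine hFη.of_norm_le_mul ht (2 / ‖u ((θ₀, 0), 0)‖) ?_
    filter_upwards [(hz.prodMk_nhds (hv j)).eventually hFW,
      hu'.eventually_const_le (half_lt_self hpos)] with k h1 h2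
    rw [h1, norm_mul]
    rw [div_mul_eq_mul_div, le_div_iff₀ hpos]
    nlinarith [norm_nonneg ((W (θ k, r k)).eval (v j k))]
  obtain ⟨i, j, hij, hflat⟩ := Polynomial.exists_flat_of_flat_eval ht (fun k => hWm (θ k, r k))
    (fun k => hWd _) v hflat
  obtain ⟨k, hk1, hk2⟩ := ((hflat (σ + 2)).and (hr0.eventually_lt_const one_pos)).exists
  have h1 : (1 : ℝ) ≤ |((i : ℕ) : ℝ) - (j : ℕ)| := by
    have h2 : ((i : ℕ) : ℤ) - (j : ℕ) ≠ 0 := by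
      rw [sub_ne_zero]
      exact_mod_cast fun h => hij (Fin.ext h)
    exact_mod_cast Int.one_le_abs h2
  have h3 := pow_pos (hrpos k) (σ + 1)
  have h2 : v i k - v j k = (((i : ℕ) : ℝ) - (j : ℕ)) * r k ^ (σ + 1) := by
    simp only [v]
    ring
  simp only [h2] at hk1
  rw [norm_mul, Real.norm_eq_abs, Real.norm_of_nonneg h3.le, pow_succ _ (σ + 1)] at hk1
  nlinarith

end Curve

section PolynomialApproximation

theorem exists_mvPolynomial_eval_eq_multilinearMap {n k : ℕ}
    (p : MultilinearMap ℝ (fun _ : Fin k => EuclideanSpace ℝ (Fin n)) ℝ) :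
    ∃ q : MvPolynomial (Fin n) ℝ, ∀ x : EuclideanSpace ℝ (Fin n),
      MvPolynomial.eval x.ofLp q = p fun _ => x := by
  classical
  let b := EuclideanSpace.basisFun (Fin n) ℝ
  refine ⟨∑ r : Fin k → Fin n, MvPolynomial.C (p fun j => b (r j)) * ∏ j, MvPolynomial.X (r j),
    fun x => ?_⟩
  have hx : x = ∑ i, x.ofLp i • b i := by
    conv_lhs => rw [← b.sum_repr x]
    simp [b]
  conv_rhs => rw [hx]
  rw [p.map_sum]
  simp only [p.map_smul_univ, map_sum, map_mul, MvPolynomial.eval_C, map_prod, MvPolynomial.eval_X,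
    smul_eq_mul]
  exact Finset.sum_congr rfl fun r _ => mul_comm _ _

theorem AnalyticAt.exists_mvPolynomial_approx {n : ℕ} {g : EuclideanSpace ℝ (Fin n) → ℝ}
    (hg : AnalyticAt ℝ g 0) (K : ℕ) : ∃ (q : MvPolynomial (Fin n) ℝ) (C : ℝ),
      ∀ᶠ x in 𝓝 (0 : EuclideanSpace ℝ (Fin n)),
        |g x - MvPolynomial.eval x.ofLp q| ≤ C * ‖x‖ ^ K := by
  obtain ⟨p, hp⟩ := hg
  choose q hq using fun k => exists_mvPolynomial_eval_eq_multilinearMap (p k).toMultilinearMap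
  obtain ⟨C, hC⟩ := (hp.isBigO_sub_partialSum_pow K).bound
  refine ⟨∑ k ∈ Finset.range K, q k, C, hC.mono fun x hx => ?_⟩
  rw [zero_add, norm_pow, norm_norm, Real.norm_eq_abs] at hx
  rw [map_sum]
  simp only [hq]
  exact hx

end PolynomialApproximation

section Nested

open MvPolynomial

/-- The polynomial whose evaluation is the square of the Euclidean norm. -/
noncomputable def normSqPolynomial (n : ℕ) : MvPolynomial (Fin n) ℝ := ∑ i, X i ^ 2

theorem eval_normSqPolynomial {n : ℕ} (x : EuclideanSpace ℝ (Fin n)) :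
    eval x.ofLp (normSqPolynomial n) = ‖x‖ ^ 2 := by
  simp [normSqPolynomial, EuclideanSpace.real_norm_sq_eq]

/-- An iterated perturbation of a polynomial `p`, whose zeros near the origin are close to points
at which `p` vanishes and the polynomials in the list are nonnegative. -/
noncomputable def nestedPolynomial {n : ℕ} (e : ℕ) :
    MvPolynomial (Fin n) ℝ → ℕ → List (MvPolynomial (Fin n) ℝ) → MvPolynomial (Fin n) ℝ
  | p, _, [] => p
  | p, a, q :: l =>
    nestedPolynomial e (p ^ 2 - normSqPolynomial n ^ a * (q + normSqPolynomial n ^ e)) (4 * a) l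

variable {n : ℕ}

theorem exists_eval_nestedPolynomial_eq_zero {γ : ℝ → EuclideanSpace ℝ (Fin n)} {r D : ℝ} {e : ℕ}
    (hr : 0 < r) (hD : 1 ≤ D) (hrD : r * D ≤ 1 / 8) (hγ : ContinuousOn γ (Icc 0 1))
    (hγr : ∀ u ∈ Icc (0 : ℝ) 1, ‖γ u‖ = r) (l : List (MvPolynomial (Fin n) ℝ))
    (hl : ∀ q ∈ l, ∀ u ∈ Icc (0 : ℝ) 1,
      -r ^ (2 * e) / 2 ≤ eval (γ u).ofLp q ∧ eval (γ u).ofLp q + r ^ (2 * e) ≤ D)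
    (p : MvPolynomial (Fin n) ℝ) (a b : ℕ) (hab : b + 1 ≤ a) (τ : ℝ) (hτ : τ ∈ Icc (0 : ℝ) 1)
    (hpτ : eval (γ τ).ofLp p = 0) (hp1 : r ^ b ≤ eval (γ 1).ofLp p) :
    ∃ u ∈ Icc (0 : ℝ) 1, eval (γ u).ofLp (nestedPolynomial e p a l) = 0 := by
  induction l generalizing p a b τ with
  | nil => exact ⟨τ, hτ, hpτ⟩
  | cons q l ih =>
    have h1 : (1 : ℝ) ∈ Icc (0 : ℝ) 1 := right_mem_Icc.2 zero_le_one
    set p₁ := p ^ 2 - normSqPolynomial n ^ a * (q + normSqPolynomial n ^ e) with hp₁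
    have heval : ∀ u ∈ Icc (0 : ℝ) 1, eval (γ u).ofLp p₁ =
        eval (γ u).ofLp p ^ 2 - r ^ (2 * a) * (eval (γ u).ofLp q + r ^ (2 * e)) := fun u hu => by
      simp [hp₁, eval_normSqPolynomial, hγr u hu, pow_mul]
    have hr1 : r ≤ 1 / 8 := by nlinarith
    have hpos : 0 < r ^ (2 * e) := by positivity
    have hneg : eval (γ τ).ofLp p₁ ≤ 0 := by
      rw [heval τ hτ, hpτ]
      have h2 := (hl q (by simp) τ hτ).1
      have h3 : 0 ≤ r ^ (2 * a) * (eval (γ τ).ofLp q + r ^ (2 * e)) :=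
        mul_nonneg (by positivity) (by linarith)
      linarith
    have hge : r ^ (2 * b + 1) ≤ eval (γ 1).ofLp p₁ := by
      rw [heval 1 h1]
      have h2 : r ^ (2 * b) ≤ eval (γ 1).ofLp p ^ 2 := by
        rw [mul_comm, pow_mul]
        gcongr
      have h3 : r ^ (2 * a) * (eval (γ 1).ofLp q + r ^ (2 * e)) ≤ r ^ (2 * b + 2) * D := by
        refine mul_le_mul (pow_le_pow_of_le_one hr.le (by linarith) (by omega))
          (hl q (by simp) 1 h1).2 ?_ (by positivity)
        have := (hl q (by simp) 1 h1).1
        linarith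
      have h4 : r ^ (2 * b + 2) * D ≤ r ^ (2 * b) * (1 / 8) := by
        calc r ^ (2 * b + 2) * D = r ^ (2 * b) * (r * (r * D)) := by ring
          _ ≤ r ^ (2 * b) * (1 / 8) := by
            gcongr
            nlinarith
      have h5 : r ^ (2 * b + 1) ≤ r ^ (2 * b) * (1 / 8) := by
        rw [pow_succ]
        gcongr
      have h6 : 0 < r ^ (2 * b) := by positivity
      linarith
    have hcont : ContinuousOn (fun u => eval (γ u).ofLp p₁) (Icc τ 1) := by
      have h2 : Continuous fun x : EuclideanSpace ℝ (Fin n) => eval x.ofLp p₁ :=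
        (MvPolynomial.continuous_eval p₁).comp (PiLp.continuous_ofLp 2 _)
      exact h2.comp_continuousOn (hγ.mono (Icc_subset_Icc_left hτ.1))
    obtain ⟨τ', hτ', hz⟩ := intermediate_value_Icc hτ.2 hcont
      ⟨hneg, (pow_nonneg hr.le _).trans hge⟩
    exact ih (fun q' hq' => hl q' (by simp [hq'])) p₁ (4 * a) (2 * b + 1) (by omega) τ'
      ⟨hτ.1.trans hτ'.1, hτ'.2⟩ hz hge

theorem le_eval_of_eval_nestedPolynomial_eq_zero {y : EuclideanSpace ℝ (Fin n)} {D : ℝ} {e : ℕ}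
    (hr : 0 < ‖y‖) (hD : 1 ≤ D) (hrD : ‖y‖ * D ≤ 1 / 8) (l : List (MvPolynomial (Fin n) ℝ))
    (hl : ∀ q ∈ l, eval y.ofLp q + ‖y‖ ^ (2 * e) ≤ D)
    (p : MvPolynomial (Fin n) ℝ) (a : ℕ) (hea : e + 1 ≤ a)
    (hp : eval y.ofLp (nestedPolynomial e p a l) = 0) :
    (∀ q ∈ l, -2 * ‖y‖ ^ (2 * e) ≤ eval y.ofLp q) ∧ |eval y.ofLp p| * ‖y‖ ≤ ‖y‖ ^ a := by
  induction l generalizing p a with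
  | nil =>
    have hp : eval y.ofLp p = 0 := hp
    exact ⟨by simp, by rw [hp]; simp⟩
  | cons q l ih =>
    obtain ⟨h1, h2⟩ := ih (fun q' hq' => hl q' (by simp [hq'])) _ (4 * a) (by omega) hp
    set r := ‖y‖
    set c := eval y.ofLp q + r ^ (2 * e) with hc
    have heval : eval y.ofLp (p ^ 2 - normSqPolynomial n ^ a * (q + normSqPolynomial n ^ e)) =
        eval y.ofLp p ^ 2 - r ^ (2 * a) * c := by
      simp [eval_normSqPolynomial, pow_mul, hc, r]
    rw [heval] at h2
    have hcD : c ≤ D := hl q (by simp)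
    have hr1 : r ≤ 1 / 8 := by nlinarith
    have hpa : 0 < r ^ (2 * a) := by positivity
    have h4a : r ^ (4 * a) = r ^ (2 * a) * r ^ (2 * a) := by ring
    have hae : r ^ (2 * a) ≤ r ^ (2 * e) * r := by
      rw [← pow_succ]
      exact pow_le_pow_of_le_one hr.le (by linarith) (by omega)
    have hle : (eval y.ofLp p ^ 2 - r ^ (2 * a) * c) * r ≤ r ^ (4 * a) :=
      (mul_le_mul_of_nonneg_right (le_abs_self _) hr.le).trans h2
    have hc1 : -r ^ (2 * e) ≤ c := by
      have h3 : -r ^ (2 * a) ≤ r * c := by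
        refine le_of_mul_le_mul_left ?_ hpa
        nlinarith [mul_nonneg (sq_nonneg (eval y.ofLp p)) hr.le]
      refine le_of_mul_le_mul_right ?_ hr
      linarith
    refine ⟨?_, ?_⟩
    · intro q' hq'
      rcases List.mem_cons.1 hq' with rfl | hq'
      · linarith
      · exact h1 q' hq'
    · refine abs_le_of_sq_le_sq' ?_ (by positivity) |>.2
      have h3 : r ^ (2 * a) ≤ 1 := pow_le_one₀ hr.le (by linarith)
      calc (|eval y.ofLp p| * r) ^ 2 = r * (eval y.ofLp p ^ 2 * r) := by
            rw [mul_pow, sq_abs]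
            ring
        _ ≤ r * (r ^ (2 * a) * r ^ (2 * a) + r * (r ^ (2 * a) * c)) := by
            gcongr
            linarith
        _ = r ^ (2 * a) * (r * r ^ (2 * a) + r * (r * c)) := by ring
        _ ≤ r ^ (2 * a) * 1 := by
            gcongr
            nlinarith [mul_le_mul_of_nonneg_left h3 hr.le, mul_le_mul_of_nonneg_left hcD hr.le]
        _ = (r ^ a) ^ 2 := by ring

end Nested

section Sphere

open MvPolynomial

theorem eventually_nhdsGT_forall_norm_eq {V : Type*} [NormedAddCommGroup V] {p : V → Prop}
    (hp : ∀ᶠ x in 𝓝[≠] (0 : V), p x) : ∀ᶠ r in 𝓝[>] (0 : ℝ), ∀ x, ‖x‖ = r → p x := by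
  rw [eventually_nhdsWithin_iff, Metric.eventually_nhds_iff_ball] at hp
  obtain ⟨ε, hε, hp⟩ := hp
  filter_upwards [Ioo_mem_nhdsGT hε] with r hr x hx
  refine hp x (by simpa [hx] using hr.2) ?_
  rintro rfl
  simp only [norm_zero] at hx
  exact hr.1.ne hx

variable {n : ℕ}

theorem AnalyticAt.exists_mvPolynomial_bounds {g : EuclideanSpace ℝ (Fin n) → ℝ}
    (hg : AnalyticAt ℝ g 0) (K e : ℕ) : ∃ q : MvPolynomial (Fin n) ℝ,
      ∀ᶠ D : ℝ in atTop, ∀ᶠ r : ℝ in 𝓝[>] 0, ∀ x, ‖x‖ = r →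
        |g x - eval x.ofLp q| ≤ D * r ^ K ∧ eval x.ofLp q + r ^ (2 * e) ≤ D ∧
          ∀ y, ‖y‖ = r → |g y - g x| ≤ D * ‖y - x‖ := by
  obtain ⟨q, C, hq⟩ := hg.exists_mvPolynomial_approx K
  obtain ⟨L, t, ht, hL⟩ := (hg.contDiffAt (n := 1)).exists_lipschitzOnWith
  have hcont : Continuous fun x : EuclideanSpace ℝ (Fin n) =>
      eval x.ofLp q + ‖x‖ ^ (2 * e) :=
    ((MvPolynomial.continuous_eval q).comp (PiLp.continuous_ofLp 2 _)).add (by fun_prop)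
  refine ⟨q, ?_⟩
  filter_upwards [eventually_ge_atTop C, eventually_ge_atTop (L : ℝ),
    eventually_gt_atTop (eval (0 : EuclideanSpace ℝ (Fin n)).ofLp q +
      ‖(0 : EuclideanSpace ℝ (Fin n))‖ ^ (2 * e))] with D hCD hLD hD
  have h1 := hcont.continuousAt.eventually (gt_mem_nhds hD)
  filter_upwards [eventually_nhdsGT_forall_norm_eq (eventually_nhdsWithin_of_eventually_nhds h1),
    eventually_nhdsGT_forall_norm_eq (eventually_nhdsWithin_of_eventually_nhds hq),
    eventually_nhdsGT_forall_norm_eq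
      (eventually_nhdsWithin_of_eventually_nhds (eventually_mem_set.2 ht)),
    eventually_mem_nhdsWithin] with r h1 h2 h3 hr x hx
  have hr : 0 < r := hr
  refine ⟨?_, ?_, fun y hy => ?_⟩
  · have := h2 x hx
    rw [hx] at this
    exact this.trans (by gcongr)
  · have := h1 x hx
    rw [hx] at this
    exact this.le
  · have := hL.dist_le_mul y (h3 y hy) x (h3 x hx)
    rw [Real.dist_eq, dist_eq_norm] at this
    exact this.trans (by gcongr)

theorem exists_mvPolynomial_sphere {α : Type} [Finite α] {g : α → EuclideanSpace ℝ (Fin n) → ℝ}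
    (hg : ∀ i, AnalyticAt ℝ (g i) 0) {f : EuclideanSpace ℝ (Fin n) → ℝ} (hf : AnalyticAt ℝ f 0)
    (hne : ¬∀ᶠ x in 𝓝 0, f x = 0) (hgf : ∀ᶠ x in 𝓝 0, (∀ i, 0 ≤ g i x) → f x = 0) (S : ℕ) :
    ∃ P : MvPolynomial (Fin n) ℝ, ∀ᶠ r in 𝓝[>] (0 : ℝ), ∀ x, ‖x‖ = r →
      ((∀ i, 0 ≤ g i x) → ∃ y, ‖y‖ = r ∧ eval y.ofLp P = 0 ∧ ‖y - x‖ ≤ r ^ S) ∧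
      (eval x.ofLp P = 0 → ∃ y, ‖y‖ = r ∧ (∀ i, 0 ≤ g i y) ∧ ‖y - x‖ ≤ r ^ S) := by
  have := Fintype.ofFinite α
  obtain ⟨e₀, he₀⟩ := exists_lojasiewicz_sphere hg S
  set e := e₀ + 1 with he
  obtain ⟨M, hM⟩ := hf.exists_spherical_curve hne (max (2 * e + 1) S)
  set K := M + 2 * e + 2 with hK
  choose q hq using fun i => (hg i).exists_mvPolynomial_bounds K e
  obtain ⟨p, hp⟩ := hf.exists_mvPolynomial_bounds K e
  obtain ⟨D, hqD, hpD, hD⟩ :=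
    ((eventually_all.2 hq).and (hp.and (eventually_ge_atTop (1 : ℝ)))).exists
  set p₀ := p ^ 2 - normSqPolynomial n ^ (M + 1) with hp₀
  refine ⟨nestedPolynomial e p₀ (2 * M + 2 + e) (Finset.univ.toList.map q), ?_⟩
  have hD8 : 0 < 1 / 8 / D := by positivity
  filter_upwards [eventually_all.2 hqD, hpD, eventually_nhdsGT_forall_norm_eq he₀,
    eventually_nhdsGT_forall_norm_eq hM,
    eventually_nhdsGT_forall_norm_eq (eventually_nhdsWithin_of_eventually_nhds hgf),
    Ioo_mem_nhdsGT hD8] with r hq hp hloj hcurve hfz hr x hx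
  obtain ⟨hr, hrD⟩ := hr
  have hrD : r * D ≤ 1 / 8 := ((lt_div_iff₀ (by positivity)).1 hrD).le
  have hr1 : r ≤ 1 / 8 := by nlinarith
  have hpow : ∀ k l : ℕ, k + 1 ≤ l → D * r ^ l ≤ r ^ k / 8 := fun k l hkl => by
    calc D * r ^ l ≤ D * r ^ (k + 1) := by
          gcongr D * ?_
          exact pow_le_pow_of_le_one hr.le (by linarith) hkl
      _ = r ^ k * (r * D) := by ring
      _ ≤ r ^ k * (1 / 8) := by gcongr
      _ = r ^ k / 8 := by ring
  have hp₀e : ∀ z : EuclideanSpace ℝ (Fin n), ‖z‖ = r →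
      eval z.ofLp p₀ = eval z.ofLp p ^ 2 - (r ^ (M + 1)) ^ 2 := fun z hz => by
    simp only [hp₀, map_sub, map_pow, eval_normSqPolynomial, hz]
    ring
  refine ⟨fun hgx => ?_, fun hPx => ?_⟩
  · obtain ⟨γ, hγ, hγ0, hγr, hγ1⟩ := hcurve x hx
    rw [hx] at hγr hγ1
    have hγn : ∀ u ∈ Icc (0 : ℝ) 1, ‖γ u‖ = r := fun u hu => (hγr u hu).1
    have hnorm₁ := hγn 1 (right_mem_Icc.2 zero_le_one)
    have hcont : ContinuousOn (fun u => eval (γ u).ofLp p₀) (Icc 0 1) := by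
      have h2 : Continuous fun x : EuclideanSpace ℝ (Fin n) => eval x.ofLp p₀ :=
        (MvPolynomial.continuous_eval p₀).comp (PiLp.continuous_ofLp 2 _)
      exact h2.comp_continuousOn hγ
    have hneg : eval (γ 0).ofLp p₀ ≤ 0 := by
      rw [hγ0, hp₀e x hx, sub_nonpos]
      have h1 := (hp x hx).1.trans (hpow (M + 1) K (by omega))
      rw [hfz x hx hgx, zero_sub, abs_neg] at h1
      have h2 : 0 < r ^ (M + 1) := by positivity
      exact sq_le_sq' (by linarith [abs_le.1 h1]) (by linarith [abs_le.1 h1])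
    have hpos : r ^ (2 * M + 1) ≤ eval (γ 1).ofLp p₀ := by
      rw [hp₀e _ hnorm₁]
      have h1 := (hp _ hnorm₁).1.trans (hpow M K (by omega))
      have h2 : r ^ M * (7 / 8) ≤ |eval (γ 1).ofLp p| := by
        have := abs_sub_abs_le_abs_sub (f (γ 1)) (eval (γ 1).ofLp p)
        linarith
      have h3 : (r ^ M * (7 / 8)) ^ 2 ≤ eval (γ 1).ofLp p ^ 2 := by
        rw [← sq_abs (eval (γ 1).ofLp p)]
        gcongr
      have h4 : r ^ (2 * M + 1) = (r ^ M) ^ 2 * r := by ring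
      have h5 : (r ^ (M + 1)) ^ 2 = (r ^ M) ^ 2 * r ^ 2 := by ring
      have h6 : 0 < (r ^ M) ^ 2 := by positivity
      nlinarith
    obtain ⟨τ, hτ, hτz⟩ := intermediate_value_Icc zero_le_one hcont
      ⟨hneg, (pow_nonneg hr.le _).trans hpos⟩
    have hl : ∀ q' ∈ Finset.univ.toList.map q, ∀ u ∈ Icc (0 : ℝ) 1,
        -r ^ (2 * e) / 2 ≤ eval (γ u).ofLp q' ∧ eval (γ u).ofLp q' + r ^ (2 * e) ≤ D := by
      simp only [List.mem_map, Finset.mem_toList, Finset.mem_univ, true_and, forall_exists_index,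
        forall_apply_eq_imp_iff]
      refine fun i u hu => ⟨?_, (hq i _ (hγn u hu)).2.1⟩
      have h1 := abs_le.1 ((hq i _ (hγn u hu)).1.trans (hpow (2 * e) K (by omega)))
      have h2 := abs_le.1 (((hq i x hx).2.2 _ (hγn u hu)).trans
        ((mul_le_mul_of_nonneg_left (hγr u hu).2 (by linarith)).trans
          (hpow (2 * e) _ (le_max_left _ _))))
      have h3 := hgx i
      have h4 : 0 < r ^ (2 * e) := by positivity
      linarith [h1.1, h1.2, h2.1]
    obtain ⟨u, hu, huz⟩ := exists_eval_nestedPolynomial_eq_zero hr hD hrD hγ hγn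
      (Finset.univ.toList.map q) (e := e) hl p₀ (2 * M + 2 + e) (2 * M + 1) (by omega) τ hτ hτz hpos
    exact ⟨γ u, hγn u hu, huz, (hγr u hu).2.trans
      (pow_le_pow_of_le_one hr.le (by linarith) (le_max_right _ _))⟩
  · obtain ⟨h1, -⟩ := le_eval_of_eval_nestedPolynomial_eq_zero (hx ▸ hr) hD (hx ▸ hrD)
      (Finset.univ.toList.map q) (e := e) (fun q' hq' => by
        obtain ⟨i, -, rfl⟩ := List.mem_map.1 hq'
        rw [hx]
        exact (hq i x hx).2.1) p₀ (2 * M + 2 + e) (by omega) hPx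
    have h2 := hloj x hx
    rw [hx] at h2 h1
    refine h2 fun i => ?_
    have h3 := h1 (q i) (List.mem_map.2 ⟨i, by simp, rfl⟩)
    have h4 := abs_le.1 ((hq i x hx).1.trans (hpow (2 * e) K (by omega)))
    have h5 : r ^ (2 * e) = r ^ e₀ * r ^ e₀ * (r * r) := by
      rw [he]
      ring
    have h6 : r ^ e₀ ≤ 1 := pow_le_one₀ hr.le (by linarith)
    have h7 : 0 < r ^ e₀ := by positivity
    have h8 : r * r ≤ 1 / 8 := by nlinarith
    have h9 : r ^ (2 * e) ≤ r ^ e₀ * (1 / 8) := by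
      rw [h5]
      have := mul_le_mul h6 h8 (by positivity) zero_le_one
      nlinarith
    linarith [h4.1]

end Sphere

section Semianalytic

open MvPolynomial

theorem exists_mvPolynomial_sphere_of_interior_eq_empty {n : ℕ} {α : Type} [Finite α] {R : ℝ}
    (hR : 0 < R) {g : α → EuclideanSpace ℝ (Fin n) → ℝ}
    (hg : ∀ i, AnalyticOnNhd ℝ (g i) (ball 0 R))
    (hempty : interior {x ∈ ball (0 : EuclideanSpace ℝ (Fin n)) R | ∀ i, 0 ≤ g i x} = ∅) (S : ℕ) :
    ∃ P : MvPolynomial (Fin n) ℝ, ∀ᶠ r in 𝓝[>] (0 : ℝ), ∀ x, ‖x‖ = r →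
      ((∀ i, 0 ≤ g i x) → ∃ y, ‖y‖ = r ∧ eval y.ofLp P = 0 ∧ ‖y - x‖ ≤ r ^ S) ∧
      (eval x.ofLp P = 0 → ∃ y, ‖y‖ = r ∧ (∀ i, 0 ≤ g i y) ∧ ‖y - x‖ ≤ r ^ S) := by
  classical
  have := Fintype.ofFinite α
  have h0 : (0 : EuclideanSpace ℝ (Fin n)) ∈ ball 0 R := mem_ball_self hR
  let β := {i : α // ¬∀ᶠ x in 𝓝 0, g i x = 0}
  have hred : ∀ x ∈ ball (0 : EuclideanSpace ℝ (Fin n)) R, (∀ i : β, 0 ≤ g i x) →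
      ∀ i, 0 ≤ g i x := fun x hx h i => by
    by_cases hi : ∀ᶠ x in 𝓝 0, g i x = 0
    · exact ((hg i).eqOn_zero_of_preconnected_of_eventuallyEq_zero
        (convex_ball 0 R).isPreconnected h0 hi hx).ge
    · exact h ⟨i, hi⟩
  have hf : AnalyticAt ℝ (fun x => ∏ i : β, g i x) 0 :=
    Finset.analyticAt_fun_prod _ fun i _ => hg i 0 h0
  have hne : ¬∀ᶠ x in 𝓝 0, ∏ i : β, g i x = 0 := fun h => by
    obtain ⟨x, hx, hx0⟩ := ((AnalyticAt.frequently_forall_ne_zero (Finset.univ : Finset β)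
      (f := fun i => g i) (fun i _ => hg i 0 h0) fun i _ => i.2).and_eventually h).exists
    exact Finset.prod_ne_zero_iff.2 hx hx0
  have hgf : ∀ᶠ x in 𝓝 0, (∀ i : β, 0 ≤ g i x) → ∏ i : β, g i x = 0 := by
    filter_upwards [ball_mem_nhds _ hR] with x hx hgx
    by_contra hprod
    have hev : ∀ᶠ y in 𝓝 x, ∀ i : β, 0 < g i y := eventually_all.2 fun i =>
      (hg i x hx).continuousAt.eventually
        (lt_mem_nhds ((hgx i).lt_of_ne' (Finset.prod_ne_zero_iff.1 hprod i (Finset.mem_univ i))))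
    have hxint : x ∈ interior {x ∈ ball (0 : EuclideanSpace ℝ (Fin n)) R | ∀ i, 0 ≤ g i x} := by
      rw [mem_interior_iff_mem_nhds]
      filter_upwards [isOpen_ball.mem_nhds hx, hev] with y hy hyg
      exact ⟨hy, hred y hy fun i => (hyg i).le⟩
    rw [hempty] at hxint
    exact hxint
  obtain ⟨P, hP⟩ := exists_mvPolynomial_sphere (g := fun i : β => g i) (fun i => hg i 0 h0)
    hf hne hgf S
  refine ⟨P, ?_⟩
  filter_upwards [hP, Ioo_mem_nhdsGT hR] with r hP hr x hx
  refine ⟨fun h => (hP x hx).1 fun i => h i, fun h => ?_⟩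
  obtain ⟨y, hy, hyg, hyx⟩ := (hP x hx).2 h
  exact ⟨y, hy, hred y (by simpa [hy] using hr.2) hyg, hyx⟩

end Semianalytic

end Helpers

/-- **Theorem 3.9 (Ferrarotti–Fortuna–Wilson).**
Let `A ⊆ Ω` be a closed set presented by finitely many real-analytic inequalities on an
open ball `Ω` centered at the origin of `ℝ^n`, with `0 ∈ A` a non-isolated point of `A`,
and assume `A` has empty interior (codimension `≥ 1`). Then for every `s ≥ 1` there is a
real polynomial `P` vanishing at `0` whose zero set `Y = P⁻¹(0)` accumulates at `0`, has
nonempty intersection with all small spheres (as does `A`), and satisfies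
`D(A ∩ S_r, Y ∩ S_r) / r^s → 0` as `r → 0⁺`. -/
theorem algebraic_approximation_of_semianalytic
    {n : ℕ} (R : ℝ) (hR : 0 < R)
    (N : ℕ) (m : Fin N → ℕ)
    (g : (j : Fin N) → Fin (m j) → EuclideanSpace ℝ (Fin n) → ℝ)
    (hg : ∀ j i, AnalyticOnNhd ℝ (g j i) (Metric.ball (0 : EuclideanSpace ℝ (Fin n)) R))
    (A : Set (EuclideanSpace ℝ (Fin n)))
    (hApres : A = ⋃ j : Fin N,
      {x ∈ Metric.ball (0 : EuclideanSpace ℝ (Fin n)) R | ∀ i : Fin (m j), 0 ≤ g j i x})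
    (hAclosed : IsClosed A)
    (h0A : (0 : EuclideanSpace ℝ (Fin n)) ∈ A)
    (h0acc : (0 : EuclideanSpace ℝ (Fin n)) ∈ closure (A \ {0}))
    (hcodim : interior A = ∅)
    (s : ℝ) (hs : 1 ≤ s) :
    ∃ (P : MvPolynomial (Fin n) ℝ) (Y : Set (EuclideanSpace ℝ (Fin n))),
      MvPolynomial.eval (0 : Fin n → ℝ) P = 0 ∧
      Y = {x : EuclideanSpace ℝ (Fin n) |
            MvPolynomial.eval ((WithLp.equiv 2 (Fin n → ℝ)) x) P = 0} ∧
      (0 : EuclideanSpace ℝ (Fin n)) ∈ closure (Y \ {0}) ∧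
      (∃ ε > 0, ∀ r : ℝ, 0 < r → r < ε →
        (A ∩ Metric.sphere (0 : EuclideanSpace ℝ (Fin n)) r).Nonempty ∧
        (Y ∩ Metric.sphere (0 : EuclideanSpace ℝ (Fin n)) r).Nonempty) ∧
      Tendsto
        (fun r : ℝ => Metric.hausdorffDist
            (A ∩ Metric.sphere (0 : EuclideanSpace ℝ (Fin n)) r)
            (Y ∩ Metric.sphere (0 : EuclideanSpace ℝ (Fin n)) r) / r ^ s)
        (nhdsWithin 0 (Set.Ioi 0)) (nhds 0) := by
  set S := ⌈s⌉₊ + 1 with hS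
  have hSs : s + 1 ≤ (S : ℝ) := by
    rw [hS]
    push_cast
    linarith [Nat.le_ceil s]
  have hA : ∀ x, x ∈ A ↔ x ∈ ball (0 : EuclideanSpace ℝ (Fin n)) R ∧ ∃ j, ∀ i, 0 ≤ g j i x :=
    fun x => by simp [hApres]
  choose P hP using fun j => exists_mvPolynomial_sphere_of_interior_eq_empty hR (hg j)
    (subset_empty_iff.1 (hcodim ▸ interior_mono (hApres ▸ subset_iUnion (fun j : Fin N =>
      {x ∈ ball (0 : EuclideanSpace ℝ (Fin n)) R | ∀ i, 0 ≤ g j i x}) j))) S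
  set Y : Set (EuclideanSpace ℝ (Fin n)) :=
    {x | MvPolynomial.eval ((WithLp.equiv 2 (Fin n → ℝ)) x) (∏ j, P j) = 0} with hYdef
  have hY : ∀ x, x ∈ Y ↔ ∃ j, MvPolynomial.eval x.ofLp (P j) = 0 := fun x => by
    have : x ∈ Y ↔ MvPolynomial.eval x.ofLp (∏ j, P j) = 0 := Iff.rfl
    rw [this, map_prod, Finset.prod_eq_zero_iff]
    simp
  have hYclosed : IsClosed Y := isClosed_eq
    ((MvPolynomial.continuous_eval (∏ j, P j)).comp (PiLp.continuous_ofLp 2 _)) continuous_const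
  have hkey : ∀ᶠ r in nhdsWithin (0 : ℝ) (Ioi 0),
      (∀ x ∈ A ∩ sphere 0 r, ∃ y ∈ Y ∩ sphere 0 r, dist x y ≤ r ^ S) ∧
        ∀ y ∈ Y ∩ sphere 0 r, ∃ x ∈ A ∩ sphere 0 r, dist y x ≤ r ^ S := by
    filter_upwards [eventually_all.2 hP, Ioo_mem_nhdsGT hR] with r hP hr
    refine ⟨fun x hx => ?_, fun y hy => ?_⟩
    · obtain ⟨-, j, hj⟩ := (hA x).1 hx.1
      obtain ⟨y, hyr, hy, hyx⟩ := (hP j x (mem_sphere_zero_iff_norm.1 hx.2)).1 hj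
      exact ⟨y, ⟨(hY y).2 ⟨j, hy⟩, mem_sphere_zero_iff_norm.2 hyr⟩, by rwa [dist_comm, dist_eq_norm]⟩
    · obtain ⟨j, hj⟩ := (hY y).1 hy.1
      obtain ⟨x, hxr, hx, hyx⟩ := (hP j y (mem_sphere_zero_iff_norm.1 hy.2)).2 hj
      exact ⟨x, ⟨(hA x).2 ⟨by simpa [hxr] using hr.2, j, hx⟩, mem_sphere_zero_iff_norm.2 hxr⟩,
        by rwa [dist_comm, dist_eq_norm]⟩
  have hAne : ∀ᶠ r in nhdsWithin (0 : ℝ) (Ioi 0), (A ∩ sphere 0 r).Nonempty := by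
    have hfreq : ∃ j, ∃ᶠ x in nhdsWithin 0 {0}ᶜ, ∀ i, 0 ≤ g j i x := by
      by_contra hcon
      rw [not_exists] at hcon
      have h1 : ∀ᶠ x in nhdsWithin (0 : EuclideanSpace ℝ (Fin n)) {0}ᶜ, ∀ j, ¬∀ i, 0 ≤ g j i x :=
        eventually_all.2 fun j => not_frequently.1 (hcon j)
      rw [mem_closure_iff_frequently] at h0acc
      refine h0acc ((eventually_nhdsWithin_iff.1 h1).mono fun x hx hxA => ?_)
      obtain ⟨-, j, hj⟩ := (hA x).1 hxA.1
      exact hx hxA.2 j hj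
    obtain ⟨j, hj⟩ := hfreq
    filter_upwards [eventually_exists_norm_eq (fun i => hg j i 0 (mem_ball_self hR)) hj,
      Ioo_mem_nhdsGT hR] with r hr hrR
    obtain ⟨x, hx, hxg⟩ := hr
    exact ⟨x, (hA x).2 ⟨by simpa [hx] using hrR.2, j, hxg⟩, mem_sphere_zero_iff_norm.2 hx⟩
  have hne : ∀ᶠ r in nhdsWithin (0 : ℝ) (Ioi 0),
      (A ∩ sphere 0 r).Nonempty ∧ (Y ∩ sphere 0 r).Nonempty := by
    filter_upwards [hAne, hkey] with r hr hk
    refine ⟨hr, ?_⟩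
    obtain ⟨x, hx⟩ := hr
    obtain ⟨y, hy, -⟩ := hk.1 x hx
    exact ⟨y, hy⟩
  obtain ⟨ε, hε, hεne⟩ := mem_nhdsGT_iff_exists_Ioo_subset.1 hne
  have hε : 0 < ε := hε
  have hYacc : (0 : EuclideanSpace ℝ (Fin n)) ∈ closure (Y \ {0}) := by
    refine Metric.mem_closure_iff.2 fun δ hδ => ?_
    obtain ⟨r, hr0, hr⟩ := exists_between (lt_min hε hδ)
    obtain ⟨y, hyY, hyr⟩ := (hεne ⟨hr0, hr.trans_le (min_le_left _ _)⟩).2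
    rw [mem_sphere_zero_iff_norm] at hyr
    refine ⟨y, ⟨hyY, ?_⟩, ?_⟩
    · rintro rfl
      simp only [norm_zero] at hyr
      exact hr0.ne hyr
    · rw [dist_zero_left, hyr]
      exact hr.trans_le (min_le_right _ _)
  refine ⟨∏ j, P j, Y, ?_, rfl, hYacc, ⟨ε, hε, fun r hr hrε => hεne ⟨hr, hrε⟩⟩, ?_⟩
  · have : (0 : EuclideanSpace ℝ (Fin n)) ∈ Y :=
      hYclosed.closure_subset_iff.2 sdiff_subset hYacc
    exact this
  · refine squeeze_zero' (g := fun r => r) ?_ ?_ (tendsto_id.mono_left nhdsWithin_le_nhds)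
    · filter_upwards [self_mem_nhdsWithin] with r hr
      exact div_nonneg hausdorffDist_nonneg (Real.rpow_nonneg (le_of_lt hr) _)
    · filter_upwards [hkey, Ioo_mem_nhdsGT zero_lt_one] with r hk hr
      rw [div_le_iff₀ (Real.rpow_pos_of_pos hr.1 _)]
      refine (hausdorffDist_le_of_mem_dist (pow_nonneg hr.1.le S) hk.1 hk.2).trans ?_
      rw [mul_comm, ← Real.rpow_add_one hr.1.ne', ← Real.rpow_natCast]
      exact Real.rpow_le_rpow_of_exponent_ge hr.1 hr.2.le hSs
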